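/- arXiv:1207.1954 — 6 statements merged into one kernel-verified Lean document; each statement's English description precedes it below -/
import Mathlib

section
/- Two Seifert matrices are rationally S-equivalent if and only if they are semi-integrally S-equivalent. -/
open Matrix

/-- The standard symplectic `2g × 2g` matrix with `g` diagonal blocks `[[0,-1],[1,0]]`. -/
def Jmat (R : Type*) [CommRing R] (g : ℕ) : Matrix (Fin (2*g)) (Fin (2*g)) R :=
  Matrix.of fun i j =>
    if i.val % 2 = 0 ∧ j.val = i.val + 1 then (-1 : R)
    else if j.val % 2 = 0 ∧ i.val = j.val + 1 then 1
    else 0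

/-- A Seifert matrix: `V - Vᵀ = J`. -/
def IsSeifert {R : Type*} [CommRing R] {g : ℕ} (V : Matrix (Fin (2*g)) (Fin (2*g)) R) : Prop :=
  V - Vᵀ = Jmat R g

/-- A symplectic matrix: `P * J * Pᵀ = J`. -/
def IsSymplectic {R : Type*} [CommRing R] {g : ℕ} (P : Matrix (Fin (2*g)) (Fin (2*g)) R) : Prop :=
  P * Jmat R g * Pᵀ = Jmat R g

/-- A rational matrix with integer entries. -/
def IsIntegralMat {n : ℕ} (P : Matrix (Fin n) (Fin n) ℚ) : Prop :=
  ∀ i j, ∃ m : ℤ, P i j = (m : ℚ)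

/-- Row enlargement `[[0,0,0],[1,x,ρᵗ],[0,ρ,V]]` of a matrix `V`. -/
def rowEnl {R : Type*} [CommRing R] {g : ℕ} (V : Matrix (Fin (2*g)) (Fin (2*g)) R)
    (x : R) (ρ : Fin (2*g) → R) : Matrix (Fin (2*(g+1))) (Fin (2*(g+1))) R :=
  Matrix.of fun i j =>
    if hi : 2 ≤ i.val then
      if hj : 2 ≤ j.val then V ⟨i.val - 2, by have := i.2; omega⟩ ⟨j.val - 2, by have := j.2; omega⟩
      else if j.val = 1 then ρ ⟨i.val - 2, by have := i.2; omega⟩ else 0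
    else
      if i.val = 0 then 0
      else
        if hj : 2 ≤ j.val then ρ ⟨j.val - 2, by have := j.2; omega⟩
        else if j.val = 0 then 1 else x

/-- Column enlargement `[[0,-1,0],[0,x,ρᵗ],[0,ρ,V]]` of a matrix `V`. -/
def colEnl {R : Type*} [CommRing R] {g : ℕ} (V : Matrix (Fin (2*g)) (Fin (2*g)) R)
    (x : R) (ρ : Fin (2*g) → R) : Matrix (Fin (2*(g+1))) (Fin (2*(g+1))) R :=
  Matrix.of fun i j =>
    if hi : 2 ≤ i.val then
      if hj : 2 ≤ j.val then V ⟨i.val - 2, by have := i.2; omega⟩ ⟨j.val - 2, by have := j.2; omega⟩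
      else if j.val = 1 then ρ ⟨i.val - 2, by have := i.2; omega⟩ else 0
    else
      if i.val = 0 then (if j.val = 1 then -1 else 0)
      else
        if hj : 2 ≤ j.val then ρ ⟨j.val - 2, by have := j.2; omega⟩
        else if j.val = 0 then 0 else x

/-- `W` is an enlargement (row or column) of `V`. -/
def IsEnlargement {R : Type*} [CommRing R] {g : ℕ} (V : Matrix (Fin (2*g)) (Fin (2*g)) R)
    (W : Matrix (Fin (2*(g+1))) (Fin (2*(g+1))) R) : Prop :=
  ∃ (x : R) (ρ : Fin (2*g) → R), W = rowEnl V x ρ ∨ W = colEnl V x ρ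

/-- The diagonal matrix `diag(n, n⁻¹, 1, …, 1)` of size `2g`. -/
def Delta (g : ℕ) (n : ℚ) : Matrix (Fin (2*g)) (Fin (2*g)) ℚ :=
  Matrix.diagonal (fun i => if i.val = 0 then n else if i.val = 1 then n⁻¹ else 1)

/-- Elementary moves for rational S-equivalence: rational symplectic congruence
and (row or column) enlargement. Reductions are the inverses of enlargements,
obtained via the symmetric closure. -/
inductive RatStep : (Σ g : ℕ, Matrix (Fin (2*g)) (Fin (2*g)) ℚ) →
    (Σ g : ℕ, Matrix (Fin (2*g)) (Fin (2*g)) ℚ) → Prop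
  | congr {g : ℕ} (V P : Matrix (Fin (2*g)) (Fin (2*g)) ℚ) (hP : IsSymplectic P) :
      RatStep ⟨g, V⟩ ⟨g, P * V * Pᵀ⟩
  | row {g : ℕ} (V : Matrix (Fin (2*g)) (Fin (2*g)) ℚ) (x : ℚ) (ρ : Fin (2*g) → ℚ) :
      RatStep ⟨g, V⟩ ⟨g+1, rowEnl V x ρ⟩
  | col {g : ℕ} (V : Matrix (Fin (2*g)) (Fin (2*g)) ℚ) (x : ℚ) (ρ : Fin (2*g) → ℚ) :
      RatStep ⟨g, V⟩ ⟨g+1, colEnl V x ρ⟩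

/-- Rational S-equivalence: the equivalence relation generated by enlargements,
reductions and rational symplectic congruences. -/
def RatSEquiv : (Σ g : ℕ, Matrix (Fin (2*g)) (Fin (2*g)) ℚ) →
    (Σ g : ℕ, Matrix (Fin (2*g)) (Fin (2*g)) ℚ) → Prop :=
  Relation.EqvGen RatStep

/-- Elementary moves for semi-integral S-equivalence: integral symplectic congruence
and (row or column) enlargement. -/
inductive SemiIntStep : (Σ g : ℕ, Matrix (Fin (2*g)) (Fin (2*g)) ℚ) →
    (Σ g : ℕ, Matrix (Fin (2*g)) (Fin (2*g)) ℚ) → Prop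
  | congr {g : ℕ} (V P : Matrix (Fin (2*g)) (Fin (2*g)) ℚ) (hPint : IsIntegralMat P)
      (hP : IsSymplectic P) : SemiIntStep ⟨g, V⟩ ⟨g, P * V * Pᵀ⟩
  | row {g : ℕ} (V : Matrix (Fin (2*g)) (Fin (2*g)) ℚ) (x : ℚ) (ρ : Fin (2*g) → ℚ) :
      SemiIntStep ⟨g, V⟩ ⟨g+1, rowEnl V x ρ⟩
  | col {g : ℕ} (V : Matrix (Fin (2*g)) (Fin (2*g)) ℚ) (x : ℚ) (ρ : Fin (2*g) → ℚ) :
      SemiIntStep ⟨g, V⟩ ⟨g+1, colEnl V x ρ⟩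

/-- Semi-integral S-equivalence: the equivalence relation generated by enlargements,
reductions and integral symplectic congruences. -/
def SemiIntSEquiv : (Σ g : ℕ, Matrix (Fin (2*g)) (Fin (2*g)) ℚ) →
    (Σ g : ℕ, Matrix (Fin (2*g)) (Fin (2*g)) ℚ) → Prop :=
  Relation.EqvGen SemiIntStep

section EnlargementCoordinates

variable {R : Type*} {g : ℕ}

/-- The vector `(a, b, y)` of length `2(g+1)`. -/
def enlVec (a b : R) (y : Fin (2*g) → R) : Fin (2*(g+1)) → R :=
  (Fin.cons a (Fin.cons b y : Fin (2*g+1) → R) : Fin (2*g+1+1) → R)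

/-- The embedding of the old indices into the indices of an enlargement. -/
def enlIdx (i : Fin (2*g)) : Fin (2*(g+1)) := (i.succ.succ : Fin (2*g+1+1))

@[simp] lemma enlIdx_val (i : Fin (2*g)) : (enlIdx i).val = i.val + 2 := rfl

/-- The first index of an enlargement. -/
def enlIdx₀ (g : ℕ) : Fin (2*(g+1)) := (0 : Fin (2*g+1+1))

/-- The second index of an enlargement. -/
def enlIdx₁ (g : ℕ) : Fin (2*(g+1)) := ((0 : Fin (2*g+1)).succ : Fin (2*g+1+1))

@[simp] lemma enlIdx₀_val : (enlIdx₀ g).val = 0 := rfl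

@[simp] lemma enlIdx₁_val : (enlIdx₁ g).val = 1 := rfl

@[simp] lemma enlVec_zero (a b : R) (y : Fin (2*g) → R) : enlVec a b y (enlIdx₀ g) = a := rfl

@[simp] lemma enlVec_one (a b : R) (y : Fin (2*g) → R) : enlVec a b y (enlIdx₁ g) = b := rfl

@[simp] lemma enlVec_idx (a b : R) (y : Fin (2*g) → R) (i : Fin (2*g)) :
    enlVec a b y (enlIdx i) = y i := rfl

lemma forall_enlIdx {p : Fin (2*(g+1)) → Prop} :
    (∀ i, p i) ↔ p (enlIdx₀ g) ∧ p (enlIdx₁ g) ∧ ∀ i : Fin (2*g), p (enlIdx i) := by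
  refine ⟨fun h => ⟨h _, h _, fun i => h _⟩, fun ⟨h0, h1, h2⟩ i => ?_⟩
  rcases i with ⟨_ | _ | i, hi⟩
  · exact h0
  · exact h1
  · exact h2 ⟨i, by omega⟩

lemma sum_enlIdx [AddCommMonoid R] (f : Fin (2*(g+1)) → R) :
    ∑ i, f i = f (enlIdx₀ g) + (f (enlIdx₁ g) + ∑ i, f (enlIdx i)) :=
  (Fin.sum_univ_succ (n := 2*g+1) f).trans
    (congrArg _ (Fin.sum_univ_succ (n := 2*g) fun i => f (Fin.succ (n := 2*g+1) i)))

lemma eq_enlVec (v : Fin (2*(g+1)) → R) :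
    v = enlVec (v (enlIdx₀ g)) (v (enlIdx₁ g)) fun i => v (enlIdx i) :=
  funext (forall_enlIdx.2 ⟨rfl, rfl, fun _ => rfl⟩)

variable [CommRing R]

lemma enlVec_dotProduct (a b a' b' : R) (y y' : Fin (2*g) → R) :
    enlVec a b y ⬝ᵥ enlVec a' b' y' = a * a' + b * b' + y ⬝ᵥ y' := by
  simp [dotProduct, sum_enlIdx, add_assoc]

variable (V : Matrix (Fin (2*g)) (Fin (2*g)) R) (x : R) (ρ : Fin (2*g) → R)

lemma rowEnl_eq : rowEnl V x ρ =
    of (enlVec (enlVec 0 0 0) (enlVec 1 x ρ) fun i => enlVec 0 (ρ i) (V i)) := by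
  ext i j
  revert i j
  simp [forall_enlIdx, rowEnl, -Fin.val_eq_zero_iff]

lemma colEnl_eq : colEnl V x ρ =
    of (enlVec (enlVec 0 (-1) 0) (enlVec 0 x ρ) fun i => enlVec 0 (ρ i) (V i)) := by
  ext i j
  revert i j
  simp [forall_enlIdx, colEnl, -Fin.val_eq_zero_iff]

lemma Jmat_succ : Jmat R (g+1) =
    of (enlVec (enlVec 0 (-1) 0) (enlVec 1 0 0) fun i => enlVec 0 0 (Jmat R g i)) := by
  ext i j
  revert i j
  simp [forall_enlIdx, Jmat, -Fin.val_eq_zero_iff]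

lemma isSeifert_rowEnl : IsSeifert (rowEnl V x ρ) ↔ IsSeifert V := by
  simp [IsSeifert, rowEnl_eq, Jmat_succ, ← Matrix.ext_iff, forall_enlIdx]

lemma isSeifert_colEnl : IsSeifert (colEnl V x ρ) ↔ IsSeifert V := by
  simp [IsSeifert, colEnl_eq, Jmat_succ, ← Matrix.ext_iff, forall_enlIdx]

lemma rowEnl_mulVec (a b : R) (y : Fin (2*g) → R) :
    rowEnl V x ρ *ᵥ enlVec a b y = enlVec 0 (a + x * b + ρ ⬝ᵥ y) (b • ρ + V *ᵥ y) := by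
  refine funext (forall_enlIdx.2 ?_)
  simp [rowEnl_eq, mulVec, enlVec_dotProduct, mul_comm]

lemma Jmat_mulVec_enlVec (a b : R) (y : Fin (2*g) → R) :
    Jmat R (g+1) *ᵥ enlVec a b y = enlVec (-b) a (Jmat R g *ᵥ y) := by
  refine funext (forall_enlIdx.2 ?_)
  simp [Jmat_succ, mulVec, enlVec_dotProduct]

end EnlargementCoordinates

section Symplectic

variable {R : Type*} [CommRing R] {g : ℕ}

lemma Jmat_transpose : (Jmat R g)ᵀ = -Jmat R g := by
  ext i j
  simp only [Jmat, transpose_apply, of_apply, Matrix.neg_apply]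
  split_ifs <;> first | omega | simp

lemma Jmat_mulVec_mulVec : ∀ {g : ℕ} (y : Fin (2*g) → R),
    Jmat R g *ᵥ (Jmat R g *ᵥ y) = -y
  | 0, y => by ext i; exact i.elim0
  | g + 1, y => by
    rw [eq_enlVec y, Jmat_mulVec_enlVec, Jmat_mulVec_enlVec, Jmat_mulVec_mulVec]
    exact funext (forall_enlIdx.2 (by simp))

lemma Jmat_mul_self : Jmat R g * Jmat R g = -1 :=
  Matrix.ext_of_mulVec_single fun i => by
    rw [← mulVec_mulVec, Jmat_mulVec_mulVec, neg_mulVec, one_mulVec]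

/-- The symplectic form with matrix `J`. -/
def sympForm (x y : Fin (2*g) → R) : R := x ⬝ᵥ Jmat R g *ᵥ y

lemma sympForm_add_left (x y z : Fin (2*g) → R) :
    sympForm (x + y) z = sympForm x z + sympForm y z := by
  simp [sympForm]

lemma sympForm_add_right (x y z : Fin (2*g) → R) :
    sympForm x (y + z) = sympForm x y + sympForm x z := by
  simp [sympForm, mulVec_add]

lemma sympForm_sub_left (x y z : Fin (2*g) → R) :
    sympForm (x - y) z = sympForm x z - sympForm y z := by
  simp [sympForm]

lemma sympForm_sub_right (x y z : Fin (2*g) → R) :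
    sympForm x (y - z) = sympForm x y - sympForm x z := by
  simp [sympForm, mulVec_sub]

lemma sympForm_smul_left (c : R) (x y : Fin (2*g) → R) :
    sympForm (c • x) y = c * sympForm x y := by
  simp [sympForm]

lemma sympForm_smul_right (c : R) (x y : Fin (2*g) → R) :
    sympForm x (c • y) = c * sympForm x y := by
  simp [sympForm, mulVec_smul]

lemma sympForm_swap (x y : Fin (2*g) → R) : sympForm x y = -sympForm y x := by
  rw [sympForm, dotProduct_mulVec, ← mulVec_transpose, Jmat_transpose, dotProduct_comm, neg_mulVec,
    dotProduct_neg, sympForm]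

lemma sympForm_self (x : Fin (2*g) → ℚ) : sympForm x x = 0 :=
  self_eq_neg.1 (sympForm_swap x x)

lemma eq_zero_of_sympForm {y : Fin (2*g) → R} (h : ∀ x, sympForm x y = 0) : y = 0 := by
  have h' : Jmat R g *ᵥ y = 0 := dotProduct_eq_zero _ fun x => by
    rw [dotProduct_comm]; exact h x
  rw [← neg_neg y, ← Jmat_mulVec_mulVec y, h', mulVec_zero, neg_zero]

variable {P Q V : Matrix (Fin (2*g)) (Fin (2*g)) R}

lemma isSymplectic_iff_sympForm :
    IsSymplectic P ↔ ∀ x y, sympForm (x ᵥ* P) (y ᵥ* P) = sympForm x y := by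
  have key (x y) : sympForm (x ᵥ* P) (y ᵥ* P) = x ⬝ᵥ (P * Jmat R g * Pᵀ) *ᵥ y := by
    rw [sympForm, ← mulVec_mulVec, ← mulVec_mulVec, mulVec_transpose, dotProduct_mulVec x P]
  simp only [key]
  refine ⟨fun h x y => by rw [h, sympForm], fun h => Matrix.ext fun i j => ?_⟩
  simpa [sympForm] using h (Pi.single i 1) (Pi.single j 1)

lemma IsSymplectic.mul (hP : IsSymplectic P) (hQ : IsSymplectic Q) : IsSymplectic (P * Q) := by
  rw [isSymplectic_iff_sympForm] at *
  intro x y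
  rw [← vecMul_vecMul, ← vecMul_vecMul, hQ, hP]

lemma IsSymplectic.isUnit (hP : IsSymplectic P) : IsUnit P := by
  refine IsUnit.of_mul_eq_one (-(Jmat R g * Pᵀ * Jmat R g)) ?_
  rw [mul_neg, ← mul_assoc, ← mul_assoc, hP, Jmat_mul_self, neg_neg]

lemma IsSymplectic.isSeifert_congr_iff (hP : IsSymplectic P) :
    IsSeifert (P * V * Pᵀ) ↔ IsSeifert V := by
  have hPt : IsUnit Pᵀ := by rw [isUnit_transpose]; exact hP.isUnit
  have key : P * V * Pᵀ - (P * V * Pᵀ)ᵀ = P * (V - Vᵀ) * Pᵀ := by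
    simp [mul_sub, sub_mul, mul_assoc]
  rw [IsSeifert, key]
  nth_rewrite 1 [← hP]
  rw [hPt.mul_left_inj, hP.isUnit.mul_right_inj, IsSeifert]

lemma IsSeifert.isSymplectic_of_congr (hV : IsSeifert V) (h : IsSeifert (P * V * Pᵀ)) :
    IsSymplectic P := by
  rw [IsSymplectic]
  nth_rewrite 1 [← hV]
  rw [← h]
  simp [mul_sub, sub_mul, mul_assoc]

/-- The symplectic transvection `x ↦ x - c ω(u, x) u`, acting on row vectors. -/
def transv (u : Fin (2*g) → R) (c : R) : Matrix (Fin (2*g)) (Fin (2*g)) R :=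
  1 - c • vecMulVec (u ᵥ* Jmat R g) u

lemma vecMul_transv (x u : Fin (2*g) → R) (c : R) :
    x ᵥ* transv u c = x - (c * sympForm u x) • u := by
  rw [transv, vecMul_sub, vecMul_one, vecMul_smul, vecMul_vecMulVec, smul_smul, sympForm,
    dotProduct_mulVec, dotProduct_comm x]

lemma transv_apply (u : Fin (2*g) → R) (c : R) (i j : Fin (2*g)) :
    transv u c i j = (1 : Matrix _ _ R) i j - c * ((u ᵥ* Jmat R g) i * u j) := by
  simp [transv, vecMulVec_apply]

end Symplectic

section Rational

variable {g : ℕ} {P Q V : Matrix (Fin (2*g)) (Fin (2*g)) ℚ}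

lemma isSymplectic_transv (u : Fin (2*g) → ℚ) (c : ℚ) : IsSymplectic (transv u c) := by
  refine isSymplectic_iff_sympForm.2 fun x y => ?_
  simp only [vecMul_transv, sympForm_sub_left, sympForm_sub_right, sympForm_smul_left,
    sympForm_smul_right, sympForm_self, sympForm_swap x u]
  ring

lemma transv_mul_transv_neg (u : Fin (2*g) → ℚ) (c : ℚ) : transv u c * transv u (-c) = 1 := by
  refine Matrix.ext_of_single_vecMul fun i => ?_
  rw [← vecMul_vecMul, vecMul_transv, vecMul_transv, vecMul_one, sympForm_sub_right,
    sympForm_smul_right, sympForm_self]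
  module

lemma transv_smul (u : Fin (2*g) → ℚ) (c t : ℚ) : transv (t • u) c = transv u (t ^ 2 * c) := by
  ext i j
  simp [transv_apply, smul_vecMul]
  ring

/-- The change of basis, integral for integral `u` and `n`, from a row enlargement of `V` to
a column enlargement of its transform under the transvection along `u`. -/
def enlTransv (u : Fin (2*g) → ℚ) (n : ℚ) : Matrix (Fin (2*(g+1))) (Fin (2*(g+1))) ℚ :=
  of (enlVec (enlVec 1 n (-u)) (enlVec 0 1 0)
    fun i => enlVec 0 (-(u ᵥ* Jmat ℚ g) i) (Pi.single i 1))

lemma enlTransv_congr (hV : IsSeifert V) (u : Fin (2*g) → ℚ) {n : ℚ} (hn : n ≠ 0) :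
    ∃ x ρ x' ρ', enlTransv u n * rowEnl V x ρ * (enlTransv u n)ᵀ =
      colEnl (transv u n⁻¹ * V * (transv u n⁻¹)ᵀ) x' ρ' := by
  set w := u ᵥ* Jmat ℚ g with hw
  set r := u ⬝ᵥ V *ᵥ u with hr
  have hVu (i) : (V *ᵥ u) i = (u ᵥ* V) i - w i := by
    rw [hw, ← hV, vecMul_sub, vecMul_transpose]; simp
  have hwu : w ⬝ᵥ u = 0 := by rw [hw, ← dotProduct_mulVec]; exact sympForm_self u
  refine ⟨-n⁻¹ + n⁻¹ ^ 2 * r, n⁻¹ • (V *ᵥ u), -n⁻¹ + n⁻¹ ^ 2 * r,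
    n⁻¹ • (V *ᵥ u) - (-n⁻¹ + n⁻¹ ^ 2 * r) • w, ?_⟩
  have entry {m : ℕ} (f : Fin m → Fin m → ℚ) (B : Matrix (Fin m) (Fin m) ℚ) (i j) :
      (of f * B * (of f)ᵀ) i j = f i ⬝ᵥ B *ᵥ f j :=
    mul_mul_apply (of f) B (of f)ᵀ i j
  have hT : transv u n⁻¹ = of fun i => Pi.single i 1 - (n⁻¹ * w i) • u := by
    ext i j; simp [transv_apply, one_apply, Pi.single_apply, eq_comm, hw, mul_assoc]
  ext i j
  rw [enlTransv, entry, hT, ← hw]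
  revert i j
  simp only [forall_enlIdx, colEnl_eq, of_apply, enlVec_zero, enlVec_one, enlVec_idx]
  have huV (j) : u ⬝ᵥ V.col j = (u ᵥ* V) j := rfl
  simp only [rowEnl_mulVec, enlVec_dotProduct, entry, mulVec_sub, mulVec_smul, mulVec_neg,
    mulVec_zero, mulVec_single_one, sub_dotProduct, dotProduct_sub, dotProduct_add, smul_dotProduct,
    dotProduct_smul, neg_dotProduct, dotProduct_neg, dotProduct_zero, zero_dotProduct,
    single_one_dotProduct, dotProduct_single_one, dotProduct_comm (V *ᵥ u) u, smul_eq_mul,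
    Pi.smul_apply, Pi.sub_apply, Pi.zero_apply, Matrix.col_apply, ← hr, huV, hVu]
  refine ⟨⟨?_, ?_, fun j => ?_⟩, ⟨?_, ?_, fun j => ?_⟩, fun i => ⟨?_, ?_, fun j => ?_⟩⟩ <;>
    field_simp <;> ring

/-- The congruences by symplectic `P` that are realized by semi-integral S-equivalences. -/
def SemiIntRealizable (P : Matrix (Fin (2*g)) (Fin (2*g)) ℚ) : Prop :=
  IsSymplectic P ∧
    ∀ V : Matrix (Fin (2*g)) (Fin (2*g)) ℚ, IsSeifert V → SemiIntSEquiv ⟨g, V⟩ ⟨g, P * V * Pᵀ⟩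

lemma SemiIntRealizable.mul (hP : SemiIntRealizable P) (hQ : SemiIntRealizable Q) :
    SemiIntRealizable (P * Q) := by
  refine ⟨hP.1.mul hQ.1, fun V hV => (hQ.2 V hV).trans _ _ _ ?_⟩
  have h := hP.2 _ (hQ.1.isSeifert_congr_iff.2 hV)
  rwa [show P * (Q * V * Qᵀ) * Pᵀ = P * Q * V * (P * Q)ᵀ by simp [mul_assoc]] at h

lemma semiIntRealizable_one : SemiIntRealizable (1 : Matrix (Fin (2*g)) (Fin (2*g)) ℚ) := by
  refine ⟨by simp [IsSymplectic], fun V _ => ?_⟩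
  rw [one_mul, transpose_one, mul_one]
  exact .refl _

lemma isIntegralMat_enlTransv (u : Fin (2*g) → ℤ) (n : ℤ) :
    IsIntegralMat (enlTransv (fun i => (u i : ℚ)) n) := by
  have hJ : Jmat ℚ g = (Jmat ℤ g).map (Int.cast : ℤ → ℚ) := by
    ext i j
    simp only [Jmat, of_apply, map_apply]
    split_ifs <;> simp
  have hw (i) : ((fun i => (u i : ℚ)) ᵥ* Jmat ℚ g) i = ((u ᵥ* Jmat ℤ g) i : ℤ) := by
    simp [hJ, vecMul, dotProduct]
  rw [IsIntegralMat]
  simp only [forall_enlIdx, enlTransv, of_apply, enlVec_zero, enlVec_one, enlVec_idx, hw]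
  refine ⟨⟨⟨1, by simp⟩, ⟨n, rfl⟩, fun i => ⟨-u i, by simp⟩⟩,
    ⟨⟨0, by simp⟩, ⟨1, by simp⟩, fun i => ⟨0, by simp⟩⟩,
    fun i => ⟨⟨0, by simp⟩, ⟨-(u ᵥ* Jmat ℤ g) i, by simp⟩,
      fun j => ⟨Pi.single (M := fun _ => ℤ) i 1 j, ?_⟩⟩⟩
  simp [Pi.single_apply]

lemma semiIntRealizable_transv_int (u : Fin (2*g) → ℤ) {n : ℤ} (hn : n ≠ 0) :
    SemiIntRealizable (transv (fun i => (u i : ℚ)) (n : ℚ)⁻¹) := by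
  refine ⟨isSymplectic_transv _ _, fun V hV => ?_⟩
  obtain ⟨x, ρ, x', ρ', h⟩ := enlTransv_congr hV (fun i => (u i : ℚ)) (Int.cast_ne_zero.2 hn)
  have hsymp : IsSymplectic (enlTransv (fun i => (u i : ℚ)) n) := by
    refine IsSeifert.isSymplectic_of_congr ((isSeifert_rowEnl V x ρ).2 hV) ?_
    rw [h, isSeifert_colEnl]
    exact (isSymplectic_transv _ _).isSeifert_congr_iff.2 hV
  refine (Relation.EqvGen.rel _ _ (SemiIntStep.row V x ρ)).trans _ _ _ ?_
  refine Relation.EqvGen.trans _ _ _ (.rel _ _ (.congr _ _ (isIntegralMat_enlTransv u n) hsymp)) ?_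
  rw [h]
  exact .symm _ _ (.rel _ _ (.col _ _ _))

lemma exists_smul_eq_intCast {ι : Type*} [Fintype ι] (u : ι → ℚ) :
    ∃ (N : ℤ) (w : ι → ℤ), N ≠ 0 ∧ (fun i => (w i : ℚ)) = (N : ℚ) • u := by
  obtain ⟨N, hN⟩ := IsLocalization.exist_integer_multiples_of_finite (nonZeroDivisors ℤ) u
  choose w hw using hN
  exact ⟨N, w, nonZeroDivisors.coe_ne_zero N, funext fun i => by simpa using hw i⟩

lemma semiIntRealizable_transv (u : Fin (2*g) → ℚ) (c : ℚ) : SemiIntRealizable (transv u c) := by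
  rcases eq_or_ne c 0 with rfl | hc
  · simpa [transv] using semiIntRealizable_one
  obtain ⟨N, w, hN, hw⟩ := exists_smul_eq_intCast (c • u)
  have hd : (c.den : ℚ) ≠ 0 := by exact_mod_cast c.den_nz
  have hN' : (N : ℚ) ≠ 0 := by exact_mod_cast hN
  have hcn : (c.num : ℚ) ≠ 0 := by exact_mod_cast Rat.num_ne_zero.2 hc
  have key := semiIntRealizable_transv_int (fun i => c.den * w i) (n := c.num * c.den * N ^ 2)
    (by exact_mod_cast (by positivity : (c.num * c.den * N ^ 2 : ℚ) ≠ 0))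
  have hu : (fun i => ((c.den * w i : ℤ) : ℚ)) = ((c.num : ℚ) * N) • u := by
    have : (fun i => ((c.den * w i : ℤ) : ℚ)) = (c.den : ℚ) • fun i => (w i : ℚ) := by
      ext i; simp
    rw [this, hw, smul_smul, smul_smul]
    congr 1
    nth_rewrite 2 [← Rat.num_div_den c]
    field_simp
  rw [hu, transv_smul] at key
  convert key using 2
  nth_rewrite 1 [← Rat.num_div_den c]
  push_cast
  field_simp

/-- The subspace of row vectors fixed by `P`. -/
def fixedSpace (P : Matrix (Fin (2*g)) (Fin (2*g)) ℚ) : Submodule ℚ (Fin (2*g) → ℚ) :=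
  LinearMap.eqLocus (vecMulLinear P) LinearMap.id

lemma mem_fixedSpace {x : Fin (2*g) → ℚ} : x ∈ fixedSpace P ↔ x ᵥ* P = x := Iff.rfl

lemma mem_fixedSpace_mul_transv {x u : Fin (2*g) → ℚ} (c : ℚ) (hx : x ∈ fixedSpace P)
    (hu : sympForm u x = 0) : x ∈ fixedSpace (P * transv u c) := by
  rw [mem_fixedSpace] at *
  rw [← vecMul_vecMul, hx, vecMul_transv, hu, mul_zero, zero_smul, sub_zero]

lemma vecMul_transv_sub {x y : Fin (2*g) → ℚ} (h : sympForm x y ≠ 0) :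
    x ᵥ* transv (x - y) (sympForm x y)⁻¹ = y := by
  rw [vecMul_transv, sympForm_sub_left, sympForm_self, zero_sub, ← sympForm_swap,
    inv_mul_cancel₀ h, one_smul, sub_sub_cancel]

lemma IsSymplectic.sympForm_vecMul_sub (hP : IsSymplectic P) {x : Fin (2*g) → ℚ}
    (hx : x ∈ fixedSpace P) (y : Fin (2*g) → ℚ) : sympForm (y ᵥ* P - y) x = 0 := by
  have h := isSymplectic_iff_sympForm.1 hP y x
  rw [mem_fixedSpace.1 hx] at h
  rw [sympForm_sub_left, h, sub_self]

lemma IsSymplectic.exists_sympForm_ne_zero (hP : IsSymplectic P) {x : Fin (2*g) → ℚ}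
    (hx : x ∉ fixedSpace P) : ∃ y, sympForm (y ᵥ* P - y) x ≠ 0 := by
  by_contra! h
  refine hx (sub_eq_zero.1 (eq_zero_of_sympForm fun z => ?_))
  obtain ⟨y, rfl⟩ := (vecMul_surjective_iff_isUnit.2 hP.isUnit) z
  change sympForm (y ᵥ* P) (x ᵥ* P - x) = 0
  rw [sympForm_sub_right, isSymplectic_iff_sympForm.1 hP]
  have := h y
  rw [sympForm_sub_left] at this
  linarith

/-- Every vector moved by a symplectic `P` can be brought back by transvections fixing everything
that `P` fixes. -/
lemma IsSymplectic.exists_mul_fixedSpace_lt (hP : IsSymplectic P) {x : Fin (2*g) → ℚ}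
    (hx : x ∉ fixedSpace P) :
    ∃ u c v d, fixedSpace P < fixedSpace (P * transv u c * transv v d) := by
  have lt {Q : Matrix (Fin (2*g)) (Fin (2*g)) ℚ} (hQ : ∀ z ∈ fixedSpace P, z ∈ fixedSpace Q)
      (hxQ : x ∈ fixedSpace Q) : fixedSpace P < fixedSpace Q :=
    SetLike.lt_iff_le_and_exists.2 ⟨hQ, x, hxQ, hx⟩
  by_cases h : sympForm (x ᵥ* P) x = 0
  · obtain ⟨s, hs₁, hs₂⟩ : ∃ s, sympForm (s ᵥ* P - s) x ≠ 0 ∧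
        sympForm (s ᵥ* P - s) (x ᵥ* P) ≠ 0 := by
      have hxP : x ᵥ* P ∉ fixedSpace P := fun h' =>
        hx (vecMul_injective_iff_isUnit.2 hP.isUnit h')
      obtain ⟨s, hs⟩ := hP.exists_sympForm_ne_zero hx
      obtain ⟨t, ht⟩ := hP.exists_sympForm_ne_zero hxP
      by_cases hs' : sympForm (s ᵥ* P - s) (x ᵥ* P) = 0
      · by_cases ht' : sympForm (t ᵥ* P - t) x = 0
        · refine ⟨s + t, ?_⟩
          rw [add_vecMul, add_sub_add_comm, sympForm_add_left, sympForm_add_left, hs', ht',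
            add_zero, zero_add]
          exact ⟨hs, ht⟩
        · exact ⟨t, ht', ht⟩
      · exact ⟨s, hs, hs'⟩
    set r := s ᵥ* P - s with hr
    have h₁ : sympForm (x ᵥ* P) (x + r) ≠ 0 := by
      rwa [sympForm_add_right, h, zero_add, sympForm_swap, neg_ne_zero]
    have h₂ : sympForm (x + r) x ≠ 0 := by rwa [sympForm_add_left, sympForm_self, zero_add]
    refine ⟨_, _, _, _, lt (Q := P * transv (x ᵥ* P - (x + r)) (sympForm (x ᵥ* P) (x + r))⁻¹ *
      transv (x + r - x) (sympForm (x + r) x)⁻¹) (fun z hz => ?_) ?_⟩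
    · refine mem_fixedSpace_mul_transv _ (mem_fixedSpace_mul_transv _ hz ?_) ?_
      · rw [← sub_sub, sympForm_sub_left, hP.sympForm_vecMul_sub hz, hP.sympForm_vecMul_sub hz,
          sub_zero]
      · rw [add_sub_cancel_left, hP.sympForm_vecMul_sub hz]
    · rw [mem_fixedSpace, ← vecMul_vecMul, ← vecMul_vecMul, vecMul_transv_sub h₁,
        vecMul_transv_sub h₂]
  · refine ⟨_, _, 0, 0, lt (Q := P * transv (x ᵥ* P - x) (sympForm (x ᵥ* P) x)⁻¹ * transv 0 0)
      (fun z hz => ?_) ?_⟩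
    · exact mem_fixedSpace_mul_transv _
        (mem_fixedSpace_mul_transv _ hz (hP.sympForm_vecMul_sub hz x)) (by simp [sympForm])
    · rw [mem_fixedSpace, ← vecMul_vecMul, ← vecMul_vecMul, vecMul_transv_sub h]
      simp [transv]

lemma SemiIntRealizable.of_mul_transv {u : Fin (2*g) → ℚ} {c : ℚ}
    (h : SemiIntRealizable (P * transv u c)) : SemiIntRealizable P := by
  simpa [mul_assoc, transv_mul_transv_neg] using h.mul (semiIntRealizable_transv u (-c))

lemma IsSymplectic.semiIntRealizable (hP : IsSymplectic P) : SemiIntRealizable P := by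
  generalize hF : fixedSpace P = F
  induction F using WellFoundedGT.induction generalizing P with
  | ind F ih =>
    subst hF
    by_cases hx : ∃ x, x ∉ fixedSpace P
    · obtain ⟨x, hx⟩ := hx
      obtain ⟨u, c, v, d, h⟩ := hP.exists_mul_fixedSpace_lt hx
      exact (ih _ h ((hP.mul (isSymplectic_transv u c)).mul (isSymplectic_transv v d))
        rfl).of_mul_transv.of_mul_transv
    · push Not at hx
      obtain rfl : P = 1 := Matrix.ext_of_single_vecMul fun i => by
        rw [vecMul_one]; exact hx _
      exact semiIntRealizable_one

end Rational

lemma RatStep.isSeifert_iff {X Y : Σ g : ℕ, Matrix (Fin (2*g)) (Fin (2*g)) ℚ} (h : RatStep X Y) :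
    IsSeifert X.2 ↔ IsSeifert Y.2 := by
  cases h with
  | congr V P hP => exact hP.isSeifert_congr_iff.symm
  | row V x ρ => exact (isSeifert_rowEnl V x ρ).symm
  | col V x ρ => exact (isSeifert_colEnl V x ρ).symm

lemma RatSEquiv.isSeifert_iff {X Y : Σ g : ℕ, Matrix (Fin (2*g)) (Fin (2*g)) ℚ}
    (h : RatSEquiv X Y) : IsSeifert X.2 ↔ IsSeifert Y.2 := by
  induction h with
  | rel _ _ h => exact h.isSeifert_iff
  | refl => rfl
  | symm _ _ _ ih => exact ih.symm
  | trans _ _ _ _ _ ih₁ ih₂ => exact ih₁.trans ih₂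

lemma SemiIntSEquiv.ratSEquiv {X Y : Σ g : ℕ, Matrix (Fin (2*g)) (Fin (2*g)) ℚ}
    (h : SemiIntSEquiv X Y) : RatSEquiv X Y := by
  induction h with
  | rel _ _ h =>
    cases h with
    | congr V P _ hP => exact .rel _ _ (.congr V P hP)
    | row V x ρ => exact .rel _ _ (.row V x ρ)
    | col V x ρ => exact .rel _ _ (.col V x ρ)
  | refl => exact .refl _
  | symm _ _ _ ih => exact .symm _ _ ih
  | trans _ _ _ _ _ ih₁ ih₂ => exact .trans _ _ _ ih₁ ih₂

lemma RatSEquiv.semiIntSEquiv {X Y : Σ g : ℕ, Matrix (Fin (2*g)) (Fin (2*g)) ℚ}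
    (h : RatSEquiv X Y) (hX : IsSeifert X.2) : SemiIntSEquiv X Y := by
  induction h with
  | rel _ _ h =>
    cases h with
    | congr V P hP => exact hP.semiIntRealizable.2 V hX
    | row V x ρ => exact .rel _ _ (.row V x ρ)
    | col V x ρ => exact .rel _ _ (.col V x ρ)
  | refl => exact .refl _
  | symm _ _ h ih => exact .symm _ _ (ih ((RatSEquiv.isSeifert_iff h).2 hX))
  | trans _ _ _ h _ ih₁ ih₂ =>
    exact .trans _ _ _ (ih₁ hX) (ih₂ ((RatSEquiv.isSeifert_iff h).1 hX))

/-- Theorem `thSeq`, first part: two Seifert matrices are rationally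
S-equivalent if and only if they are semi-integrally S-equivalent. -/
theorem rat_SEquiv_iff_semiInt_SEquiv
    (X Y : Σ g : ℕ, Matrix (Fin (2*g)) (Fin (2*g)) ℚ)
    (hX : IsSeifert X.2) (hY : IsSeifert Y.2) :
    RatSEquiv X Y ↔ SemiIntSEquiv X Y := by
  exact ⟨fun h => h.semiIntSEquiv hX, SemiIntSEquiv.ratSEquiv⟩
end

section
/- Every symplectic matrix P ∈ M_{2g}(ℚ) can be written as a finite product of matrices, each of which is either an integral symplectic matrix or a matrix Δ_n or Δ_n^{-1} for some positive integer n. -/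
open Matrix

namespace RatSymplectic

/-- The index paired with `i` by the form `Jmat`. -/
def partner {g : ℕ} (i : Fin (2*g)) : Fin (2*g) :=
  if h : i.val % 2 = 0 then ⟨i.val + 1, by have := i.2; omega⟩
  else ⟨i.val - 1, by have := i.2; omega⟩

/-- The nonzero entry in row `i` of `Jmat`. -/
def pairSign {g : ℕ} (i : Fin (2*g)) : ℚ := if i.val % 2 = 0 then -1 else 1

lemma partner_val {g : ℕ} (i : Fin (2*g)) :
    (partner i).val = if i.val % 2 = 0 then i.val + 1 else i.val - 1 := by
  unfold partner; split_ifs <;> rfl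

lemma partner_partner {g : ℕ} (i : Fin (2*g)) : partner (partner i) = i := by
  ext; simp only [partner_val]; split_ifs <;> omega

lemma partner_ne {g : ℕ} (i : Fin (2*g)) : partner i ≠ i := by
  intro h
  have := congrArg Fin.val h
  rw [partner_val] at this
  split_ifs at this <;> omega

lemma pairSign_partner {g : ℕ} (i : Fin (2*g)) : pairSign (partner i) = -pairSign i := by
  unfold pairSign; rw [partner_val]; split_ifs <;> first | omega | simp

lemma pairSign_eq {g : ℕ} (i : Fin (2*g)) : pairSign i = 1 ∨ pairSign i = -1 := by
  unfold pairSign; split_ifs <;> simp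

lemma pairSign_ne_zero {g : ℕ} (i : Fin (2*g)) : pairSign i ≠ 0 := by
  rcases pairSign_eq i with h | h <;> rw [h] <;> norm_num

lemma jmat_apply {g : ℕ} (i j : Fin (2*g)) :
    Jmat ℚ g i j = if j = partner i then pairSign i else 0 := by
  simp only [Jmat, of_apply, pairSign, Fin.ext_iff, partner_val]
  split_ifs <;> first | rfl | omega

/-- The symplectic form with Gram matrix `Jmat`. -/
def form {g : ℕ} (x y : Fin (2*g) → ℚ) : ℚ := x ⬝ᵥ Jmat ℚ g *ᵥ y

lemma form_eq_sum {g : ℕ} (x y : Fin (2*g) → ℚ) :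
    form x y = ∑ i, x i * (pairSign i * y (partner i)) := by
  simp [form, dotProduct, mulVec, jmat_apply]

lemma form_add_left {g : ℕ} (x y z : Fin (2*g) → ℚ) : form (x + y) z = form x z + form y z := by
  simp [form, add_dotProduct]

lemma form_add_right {g : ℕ} (x y z : Fin (2*g) → ℚ) : form x (y + z) = form x y + form x z := by
  simp [form, mulVec_add, dotProduct_add]

lemma form_sub_right {g : ℕ} (x y z : Fin (2*g) → ℚ) : form x (y - z) = form x y - form x z := by
  simp [form, mulVec_sub, dotProduct_sub]

lemma form_smul_left {g : ℕ} (c : ℚ) (x y : Fin (2*g) → ℚ) : form (c • x) y = c * form x y := by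
  simp [form, smul_dotProduct]

lemma form_smul_right {g : ℕ} (c : ℚ) (x y : Fin (2*g) → ℚ) : form x (c • y) = c * form x y := by
  simp [form, mulVec_smul, dotProduct_smul]

lemma form_swap {g : ℕ} (x y : Fin (2*g) → ℚ) : form x y = -form y x := by
  rw [form_eq_sum, form_eq_sum, ← Finset.sum_neg_distrib]
  refine Finset.sum_bij' (fun i _ => partner i) (fun i _ => partner i) ?_ ?_ ?_ ?_ ?_ <;>
    simp [partner_partner, pairSign_partner]
  intro i
  ring

lemma form_self {g : ℕ} (x : Fin (2*g) → ℚ) : form x x = 0 := by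
  linarith [form_swap x x]

lemma form_single_right {g : ℕ} (x : Fin (2*g) → ℚ) (i : Fin (2*g)) :
    form x (Pi.single (partner i) 1) = x i * pairSign i := by
  rw [form_eq_sum, Finset.sum_eq_single i] <;> simp
  intro j hj
  right; right
  rw [Pi.single_apply, if_neg]
  intro h
  apply hj
  rw [← partner_partner j, h, partner_partner]

lemma eq_zero_of_form_eq_zero {g : ℕ} (v : Fin (2*g) → ℚ) (h : ∀ x, form x v = 0) : v = 0 := by
  funext i
  have := h (Pi.single (partner i) 1)
  rw [form_swap, form_single_right] at this
  simpa [pairSign_ne_zero] using this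

lemma isSymplectic_iff {g : ℕ} (P : Matrix (Fin (2*g)) (Fin (2*g)) ℚ) :
    IsSymplectic P ↔ ∀ x y, form (x ᵥ* P) (y ᵥ* P) = form x y := by
  have key : ∀ x y, form (x ᵥ* P) (y ᵥ* P) = x ⬝ᵥ (P * Jmat ℚ g * Pᵀ) *ᵥ y := by
    intro x y
    rw [form, ← mulVec_transpose P y, ← dotProduct_mulVec, mulVec_mulVec, mulVec_mulVec,
      Matrix.mul_assoc]
  constructor
  · intro h x y
    rw [key, h, form]
  · intro h
    ext i j
    have := h (Pi.single i 1) (Pi.single j 1)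
    rw [key, form] at this
    simpa using this

lemma eq_of_vecMul_eq {n : ℕ} {A B : Matrix (Fin n) (Fin n) ℚ} (h : ∀ x, x ᵥ* A = x ᵥ* B) :
    A = B := by
  ext i j
  simpa using congrFun (h (Pi.single i 1)) j

/-- The symplectic transvection `x ↦ x + a ω(x, v) v`, acting on row vectors. -/
def transv {g : ℕ} (v : Fin (2*g) → ℚ) (a : ℚ) : Matrix (Fin (2*g)) (Fin (2*g)) ℚ :=
  1 + a • vecMulVec (Jmat ℚ g *ᵥ v) v

lemma vecMul_transv {g : ℕ} (x v : Fin (2*g) → ℚ) (a : ℚ) :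
    x ᵥ* transv v a = x + (a * form x v) • v := by
  simp [transv, vecMul_add, vecMul_smul, vecMul_vecMulVec, form, smul_smul]

lemma transv_symplectic {g : ℕ} (v : Fin (2*g) → ℚ) (a : ℚ) : IsSymplectic (transv v a) := by
  rw [isSymplectic_iff]
  intro x y
  simp only [vecMul_transv, form_add_left, form_add_right, form_smul_left, form_smul_right,
    form_self]
  rw [form_swap v y]
  ring

lemma transv_mul_neg {g : ℕ} (v : Fin (2*g) → ℚ) (a : ℚ) :
    transv v a * transv v (-a) = 1 := by
  apply eq_of_vecMul_eq
  intro x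
  rw [← vecMul_vecMul, vecMul_transv, vecMul_transv, form_add_left, form_smul_left, form_self]
  simp

lemma transv_smul {g : ℕ} (v : Fin (2*g) → ℚ) (c a : ℚ) :
    transv (c • v) a = transv v (c ^ 2 * a) := by
  apply eq_of_vecMul_eq
  intro x
  rw [vecMul_transv, vecMul_transv, form_smul_right, smul_smul]
  ring_nf

lemma transv_zero {g : ℕ} (a : ℚ) : transv (0 : Fin (2*g) → ℚ) a = 1 := by
  simp [transv]

lemma transv_vecMul {g : ℕ} {A B : Matrix (Fin (2*g)) (Fin (2*g)) ℚ} (hB : IsSymplectic B)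
    (hAB : A * B = 1) (v : Fin (2*g) → ℚ) (a : ℚ) :
    transv (v ᵥ* B) a = A * transv v a * B := by
  rw [isSymplectic_iff] at hB
  apply eq_of_vecMul_eq
  intro x
  rw [← vecMul_vecMul, ← vecMul_vecMul, vecMul_transv, vecMul_transv, add_vecMul, vecMul_vecMul,
    hAB, vecMul_one, smul_vecMul, ← hB (x ᵥ* A) v, vecMul_vecMul, hAB, vecMul_one]

/-- A rational vector with integer entries. -/
def IsIntegralVec {n : ℕ} (v : Fin n → ℚ) : Prop := ∀ i, ∃ m : ℤ, v i = m

lemma IsIntegralVec.add {n : ℕ} {v w : Fin n → ℚ} (hv : IsIntegralVec v) (hw : IsIntegralVec w) :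
    IsIntegralVec (v + w) := by
  intro i
  obtain ⟨a, ha⟩ := hv i
  obtain ⟨b, hb⟩ := hw i
  exact ⟨a + b, by simp [ha, hb]⟩

lemma IsIntegralVec.sub {n : ℕ} {v w : Fin n → ℚ} (hv : IsIntegralVec v) (hw : IsIntegralVec w) :
    IsIntegralVec (v - w) := by
  intro i
  obtain ⟨a, ha⟩ := hv i
  obtain ⟨b, hb⟩ := hw i
  exact ⟨a - b, by simp [ha, hb]⟩

lemma isIntegralVec_single {n : ℕ} (i : Fin n) : IsIntegralVec (Pi.single i (1 : ℚ)) := by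
  intro j
  rw [Pi.single_apply]
  split_ifs
  · exact ⟨1, by simp⟩
  · exact ⟨0, by simp⟩

lemma exists_ne_zero_smul_isIntegralVec {n : ℕ} (v : Fin n → ℚ) :
    ∃ D : ℚ, D ≠ 0 ∧ IsIntegralVec (D • v) := by
  refine ⟨∏ i, ((v i).den : ℚ), by simp [Finset.prod_ne_zero_iff], fun i => ?_⟩
  refine ⟨(∏ j ∈ Finset.univ.erase i, ((v j).den : ℤ)) * (v i).num, ?_⟩
  rw [Pi.smul_apply, smul_eq_mul, ← Finset.mul_prod_erase _ _ (Finset.mem_univ i)]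
  push_cast
  rw [mul_comm (((v i).den : ℚ)), mul_assoc, Rat.den_mul_eq_num]

lemma transv_integral {g : ℕ} {v : Fin (2*g) → ℚ} (hv : IsIntegralVec v) (a : ℤ) :
    IsIntegralMat (transv v a) := by
  intro i j
  obtain ⟨s, hs⟩ : ∃ s : ℤ, pairSign i = s := by
    rcases pairSign_eq i with h | h
    · exact ⟨1, by simp [h]⟩
    · exact ⟨-1, by simp [h]⟩
  obtain ⟨b, hb⟩ := hv (partner i)
  obtain ⟨c, hc⟩ := hv j
  refine ⟨(if i = j then 1 else 0) + a * (s * b * c), ?_⟩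
  have : (Jmat ℚ g *ᵥ v) i = s * b := by
    simp [mulVec, dotProduct, jmat_apply, hs, hb]
  simp [transv, one_apply, vecMulVec_apply, this, hc]

lemma delta_symplectic {g : ℕ} {n : ℚ} (hn : n ≠ 0) : IsSymplectic (Delta g n) := by
  rw [isSymplectic_iff]
  intro x y
  simp only [form_eq_sum, Delta, vecMul_diagonal]
  refine Finset.sum_congr rfl fun i _ => ?_
  rw [partner_val]
  split_ifs <;> first | contradiction | omega | field_simp

lemma delta_mul_delta_inv {g : ℕ} {n : ℚ} (hn : n ≠ 0) : Delta g n * Delta g n⁻¹ = 1 := by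
  rw [Delta, Delta, diagonal_mul_diagonal, ← diagonal_one]
  congr 1
  funext i
  split_ifs <;> simp [hn]

/-- The monoid generated by the integral symplectic matrices and the `Δ_n`, `Δ_n⁻¹`. -/
def genMonoid (g : ℕ) : Submonoid (Matrix (Fin (2*g)) (Fin (2*g)) ℚ) :=
  Submonoid.closure {Q | (IsIntegralMat Q ∧ IsSymplectic Q) ∨
    ∃ n : ℕ, 0 < n ∧ (Q = Delta g (n : ℚ) ∨ Q = Delta g ((n : ℚ)⁻¹))}

/-- All transvections along `v` lie in `genMonoid`. -/
def Good {g : ℕ} (v : Fin (2*g) → ℚ) : Prop := ∀ a, transv v a ∈ genMonoid g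

lemma transv_mem_of_integral {g : ℕ} {v : Fin (2*g) → ℚ} (hv : IsIntegralVec v) (a : ℤ) :
    transv v a ∈ genMonoid g :=
  Submonoid.subset_closure (Or.inl ⟨transv_integral hv a, transv_symplectic v a⟩)

lemma Good.vecMul {g : ℕ} {v : Fin (2*g) → ℚ} (hv : Good v)
    {A B : Matrix (Fin (2*g)) (Fin (2*g)) ℚ} (hB : IsSymplectic B) (hAB : A * B = 1)
    (hA : A ∈ genMonoid g) (hB' : B ∈ genMonoid g) : Good (v ᵥ* B) := by
  intro a
  rw [transv_vecMul hB hAB]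
  exact mul_mem (mul_mem hA (hv a)) hB'

lemma Good.smul {g : ℕ} {v : Fin (2*g) → ℚ} (hv : Good v) (c : ℚ) : Good (c • v) := by
  intro a
  rw [transv_smul]
  exact hv _

lemma Good.of_form_eq {g : ℕ} {u w : Fin (2*g) → ℚ} (hu : Good u) (hui : IsIntegralVec u)
    (hwi : IsIntegralVec w) (h : form u w = 1 ∨ form u w = -1) : Good w := by
  obtain ⟨e, he, hee⟩ : ∃ e : ℤ, form u w = e ∧ e * e = 1 := by
    rcases h with h | h
    · exact ⟨1, by simp [h]⟩
    · exact ⟨-1, by simp [h]⟩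
  have hw : w = u ᵥ* transv (w - u) e := by
    rw [vecMul_transv, form_sub_right, form_self, he, sub_zero]
    have : (e : ℚ) * e = 1 := by exact_mod_cast hee
    rw [this]; simp
  rw [hw]
  have hi := hwi.sub hui
  refine hu.vecMul (A := transv (w - u) (-e)) (transv_symplectic _ _) ?_ ?_
    (transv_mem_of_integral hi e)
  · simpa using transv_mul_neg (w - u) (-e)
  · exact_mod_cast transv_mem_of_integral hi (-e)

lemma good_single_zero {g : ℕ} (hg : 0 < 2 * g) : Good (Pi.single (⟨0, hg⟩ : Fin (2*g)) 1) := by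
  intro a
  have hd : (a.den : ℚ) ≠ 0 := by exact_mod_cast a.den_nz
  have h1 := transv_vecMul (delta_symplectic (g := g) (inv_ne_zero hd)) (delta_mul_delta_inv hd)
    (Pi.single (⟨0, hg⟩ : Fin (2*g)) 1) ((a.num * a.den : ℤ) : ℚ)
  have h2 : (Pi.single (⟨0, hg⟩ : Fin (2*g)) 1) ᵥ* Delta g (a.den : ℚ)⁻¹
      = (a.den : ℚ)⁻¹ • (Pi.single (⟨0, hg⟩ : Fin (2*g)) (1 : ℚ)) := by
    funext i
    rw [Delta, vecMul_diagonal, Pi.smul_apply, Pi.single_apply]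
    split_ifs <;> simp_all [Fin.ext_iff]
  have h3 : ((a.den : ℚ)⁻¹) ^ 2 * ((a.num * a.den : ℤ) : ℚ) = a := by
    push_cast
    conv_rhs => rw [← Rat.num_div_den a]
    field_simp
  rw [h2, transv_smul, h3] at h1
  rw [h1]
  refine mul_mem (mul_mem ?_ (transv_mem_of_integral (isIntegralVec_single _) _)) ?_
  · exact Submonoid.subset_closure (Or.inr ⟨a.den, a.den_pos, Or.inl rfl⟩)
  · exact Submonoid.subset_closure (Or.inr ⟨a.den, a.den_pos, Or.inr rfl⟩)

lemma Good.single_partner {g : ℕ} {u : Fin (2*g) → ℚ} (hu : Good u) (hui : IsIntegralVec u)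
    {i : Fin (2*g)} (h : u i = 1) : Good (Pi.single (partner i) (1 : ℚ)) := by
  refine hu.of_form_eq hui (isIntegralVec_single _) ?_
  rw [form_single_right, h, one_mul]
  exact pairSign_eq i

lemma good_of_single_partner {g : ℕ} {u : Fin (2*g) → ℚ} {i : Fin (2*g)}
    (hi : Good (Pi.single (partner i) (1 : ℚ))) (hui : IsIntegralVec u) (h : u i = 1) :
    Good u := by
  refine hi.of_form_eq (isIntegralVec_single _) hui ?_
  rw [form_swap, form_single_right, h, one_mul, neg_inj, neg_eq_iff_eq_neg]
  exact (pairSign_eq i).symm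

lemma good_single {g : ℕ} (i : Fin (2*g)) : Good (Pi.single i (1 : ℚ)) := by
  have hg : 0 < 2 * g := by have := i.2; omega
  set z : Fin (2*g) := ⟨0, hg⟩
  have hz : Good (Pi.single z 1) := good_single_zero hg
  have hz' : Good (Pi.single (partner z) 1) := hz.single_partner (isIntegralVec_single _) (by simp)
  by_cases h0 : partner i = z
  · rw [← partner_partner i, h0]; exact hz'
  have hu : IsIntegralVec (Pi.single z 1 + Pi.single (partner i) (1 : ℚ)) :=
    (isIntegralVec_single _).add (isIntegralVec_single _)
  have hgood := good_of_single_partner hz' hu (by simp [Ne.symm h0])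
  have := hgood.single_partner hu (i := partner i) (by simp [h0])
  rwa [partner_partner] at this

lemma good_all {g : ℕ} (v : Fin (2*g) → ℚ) : Good v := by
  by_cases hv : v = 0
  · intro a
    rw [hv, transv_zero]
    exact one_mem _
  obtain ⟨i, hi⟩ := Function.ne_iff.mp hv
  rw [Pi.zero_apply] at hi
  obtain ⟨D, hD, hDv⟩ := exists_ne_zero_smul_isIntegralVec v
  have hs := pairSign_ne_zero i
  set e : Fin (2*g) → ℚ := Pi.single (partner i) 1 with he
  set b : ℚ := (D⁻¹ - v (partner i)) / (v i * pairSign i) with hb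
  have hv' : v ᵥ* transv e b = v + (D⁻¹ - v (partner i)) • e := by
    rw [vecMul_transv, he, form_single_right, hb]
    congr 2
    field_simp
  have hp : (D • (v ᵥ* transv e b)) (partner i) = 1 := by
    rw [hv']; simp [he, hD]
  have hint : IsIntegralVec (D • (v ᵥ* transv e b)) := by
    intro j
    by_cases hj : j = partner i
    · exact ⟨1, by rw [hj, hp]; simp⟩
    · obtain ⟨m, hm⟩ := hDv j
      refine ⟨m, ?_⟩
      rw [hv', ← hm]
      simp [he, hj]
  have h1 : Good (D • (v ᵥ* transv e b)) :=
    good_of_single_partner (good_single _) hint hp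
  have h2 : Good (v ᵥ* transv e b) := by
    have := h1.smul D⁻¹
    rwa [smul_smul, inv_mul_cancel₀ hD, one_smul] at this
  have h3 : Good ((v ᵥ* transv e b) ᵥ* transv e (-b)) :=
    h2.vecMul (transv_symplectic _ _) (transv_mul_neg e b) (good_single _ b) (good_single _ (-b))
  rwa [vecMul_vecMul, transv_mul_neg, vecMul_one] at h3

lemma isSymplectic_mul_transv {g : ℕ} {P : Matrix (Fin (2*g)) (Fin (2*g)) ℚ}
    (hP : IsSymplectic P) (v : Fin (2*g) → ℚ) (a : ℚ) : IsSymplectic (P * transv v a) := by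
  have hT := transv_symplectic v a
  rw [isSymplectic_iff] at *
  intro x y
  rw [← vecMul_vecMul, ← vecMul_vecMul, hT, hP]

lemma mem_of_mul_transv_mem {g : ℕ} {P : Matrix (Fin (2*g)) (Fin (2*g)) ℚ}
    {v : Fin (2*g) → ℚ} {a : ℚ} (h : P * transv v a ∈ genMonoid g) : P ∈ genMonoid g := by
  have := mul_mem h (good_all v (-a))
  rwa [Matrix.mul_assoc, transv_mul_neg, Matrix.mul_one] at this

/-- The row vectors fixed by `P`. -/
def fixedSpace {n : ℕ} (P : Matrix (Fin n) (Fin n) ℚ) : Submodule ℚ (Fin n → ℚ) :=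
  LinearMap.eqLocus P.vecMulLinear LinearMap.id

lemma mem_fixedSpace {n : ℕ} {P : Matrix (Fin n) (Fin n) ℚ} {x : Fin n → ℚ} :
    x ∈ fixedSpace P ↔ x ᵥ* P = x := by
  simp [fixedSpace, LinearMap.mem_eqLocus]

lemma fixedSpace_le_mul_transv {g : ℕ} {P : Matrix (Fin (2*g)) (Fin (2*g)) ℚ}
    (hP : IsSymplectic P) (x : Fin (2*g) → ℚ) (a : ℚ) :
    fixedSpace P ≤ fixedSpace (P * transv (x ᵥ* P - x) a) := by
  rw [isSymplectic_iff] at hP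
  intro y hy
  rw [mem_fixedSpace] at *
  have : form y (x ᵥ* P - x) = 0 := by
    rw [form_sub_right, sub_eq_zero, ← hP y x, hy]
  rw [← vecMul_vecMul, hy, vecMul_transv, this]
  simp

lemma fixedSpace_lt_mul_transv {g : ℕ} {P : Matrix (Fin (2*g)) (Fin (2*g)) ℚ}
    (hP : IsSymplectic P) (x : Fin (2*g) → ℚ) (hx : form x (x ᵥ* P) ≠ 0) :
    ∃ a, fixedSpace P < fixedSpace (P * transv (x ᵥ* P - x) a) := by
  refine ⟨-(form x (x ᵥ* P))⁻¹, lt_of_le_of_ne (fixedSpace_le_mul_transv hP x _) fun h => hx ?_⟩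
  have hmem : x ∈ fixedSpace (P * transv (x ᵥ* P - x) (-(form x (x ᵥ* P))⁻¹)) := by
    rw [mem_fixedSpace, ← vecMul_vecMul, vecMul_transv, form_sub_right, form_self,
      form_swap (x ᵥ* P) x, zero_sub, neg_neg, neg_mul, inv_mul_cancel₀ hx]
    simp
  rw [← h, mem_fixedSpace] at hmem
  rw [hmem, form_self]

lemma exists_lt_fixedSpace {g : ℕ} {P : Matrix (Fin (2*g)) (Fin (2*g)) ℚ}
    (hP : IsSymplectic P) (h1 : P ≠ 1) :
    ∃ Q, IsSymplectic Q ∧ fixedSpace P < fixedSpace Q ∧ (Q ∈ genMonoid g → P ∈ genMonoid g) := by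
  by_cases h : ∃ x, form x (x ᵥ* P) ≠ 0
  · obtain ⟨x, hx⟩ := h
    obtain ⟨a, ha⟩ := fixedSpace_lt_mul_transv hP x hx
    exact ⟨_, isSymplectic_mul_transv hP _ _, ha, mem_of_mul_transv_mem⟩
  push Not at h
  obtain ⟨y, hy⟩ : ∃ y, y ᵥ* P - y ≠ 0 := by
    by_contra! hc
    exact h1 (eq_of_vecMul_eq fun x => by rw [sub_eq_zero.mp (hc x), vecMul_one])
  obtain ⟨x, hx⟩ : ∃ x, form x (y ᵥ* P - y) ≠ 0 := by
    by_contra! hc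
    exact hy (eq_zero_of_form_eq_zero _ hc)
  have hxy : form (x ᵥ* P) (y ᵥ* P - y) = -form x (y ᵥ* P - y) := by
    have h2 := h (x + y)
    rw [add_vecMul, form_add_left, form_add_right, form_add_right, h x, h y] at h2
    rw [form_sub_right, form_sub_right, (isSymplectic_iff P).mp hP, form_swap (x ᵥ* P) y]
    linarith
  have hP' := isSymplectic_mul_transv hP (y ᵥ* P - y) 1
  have hx' : form x (x ᵥ* (P * transv (y ᵥ* P - y) 1)) ≠ 0 := by
    rw [← vecMul_vecMul, vecMul_transv, form_add_right, form_smul_right, h x, hxy]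
    simpa using hx
  obtain ⟨a, ha⟩ := fixedSpace_lt_mul_transv hP' x hx'
  exact ⟨_, isSymplectic_mul_transv hP' _ _, (fixedSpace_le_mul_transv hP y 1).trans_lt ha,
    fun hQ => mem_of_mul_transv_mem (mem_of_mul_transv_mem hQ)⟩

lemma mem_genMonoid {g : ℕ} (W : Submodule ℚ (Fin (2*g) → ℚ)) :
    ∀ P, IsSymplectic P → fixedSpace P = W → P ∈ genMonoid g := by
  induction W using WellFoundedGT.induction with
  | ind W ih =>
    intro P hP hW
    by_cases h1 : P = 1
    · rw [h1]; exact one_mem _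
    · obtain ⟨Q, hQ, hlt, hmem⟩ := exists_lt_fixedSpace hP h1
      exact hmem (ih _ (hW ▸ hlt) Q hQ rfl)

end RatSymplectic

/-- Lemma `lemmasymp`: every rational symplectic matrix is a finite
product of matrices each of which is integral symplectic, or equal to `Δ_n` or `Δ_n⁻¹`
for some positive integer `n`. -/
theorem symplectic_eq_prod_integral_and_delta {g : ℕ}
    (P : Matrix (Fin (2*g)) (Fin (2*g)) ℚ) (hP : IsSymplectic P) :
    ∃ L : List (Matrix (Fin (2*g)) (Fin (2*g)) ℚ),
      P = L.prod ∧
      ∀ Q ∈ L, (IsIntegralMat Q ∧ IsSymplectic Q) ∨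
        ∃ n : ℕ, 0 < n ∧ (Q = Delta g (n : ℚ) ∨ Q = Delta g ((n : ℚ)⁻¹)) := by
  obtain ⟨L, hL, hprod⟩ := Submonoid.exists_list_of_mem_closure
    (RatSymplectic.mem_genMonoid _ P hP rfl)
  exact ⟨L, hprod.symm, hL⟩
end

section
/- Let n be a positive integer. Let V, W ∈ M_{2g}(ℤ) be integral Seifert matrices such that W = Δ_n V Δ_n and such that n divides every entry of the second row of V. Then there exist an integral enlargement Ṽ of V, an integral enlargement W̃ of W, and an integral symplectic matrix P ∈ M_{2g+2}(ℤ) such that W̃ = P Ṽ Pᵗ; in particular, V and W are integrally S-equivalent. -/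
open Matrix

/-- Elementary moves for integral S-equivalence of integral Seifert matrices. -/
inductive IntStep : (Σ g : ℕ, Matrix (Fin (2*g)) (Fin (2*g)) ℤ) →
    (Σ g : ℕ, Matrix (Fin (2*g)) (Fin (2*g)) ℤ) → Prop
  | congr {g : ℕ} (V P : Matrix (Fin (2*g)) (Fin (2*g)) ℤ) (hP : IsSymplectic P) :
      IntStep ⟨g, V⟩ ⟨g, P * V * Pᵀ⟩
  | row {g : ℕ} (V : Matrix (Fin (2*g)) (Fin (2*g)) ℤ) (x : ℤ) (ρ : Fin (2*g) → ℤ) :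
      IntStep ⟨g, V⟩ ⟨g+1, rowEnl V x ρ⟩
  | col {g : ℕ} (V : Matrix (Fin (2*g)) (Fin (2*g)) ℤ) (x : ℤ) (ρ : Fin (2*g) → ℤ) :
      IntStep ⟨g, V⟩ ⟨g+1, colEnl V x ρ⟩

/-- Integral S-equivalence: the equivalence relation generated by integral enlargements,
integral reductions and integral symplectic congruences. -/
def IntSEquiv : (Σ g : ℕ, Matrix (Fin (2*g)) (Fin (2*g)) ℤ) →
    (Σ g : ℕ, Matrix (Fin (2*g)) (Fin (2*g)) ℤ) → Prop :=
  Relation.EqvGen IntStep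

/-- The integral symplectic matrix relating a column enlargement of `V` to a row enlargement of
`Δ_n V Δ_n`. -/
def deltaTransition (h : ℕ) (n : ℤ) : Matrix (Fin (2*(h+1+1))) (Fin (2*(h+1+1))) ℤ :=
  Matrix.of fun i j =>
    if i.val = 0 then
      -n * (if (⟨1, by omega⟩ : Fin (2*(h+1+1))) = j then 1 else 0)
        + (if (⟨3, by omega⟩ : Fin (2*(h+1+1))) = j then 1 else 0)
    else if i.val = 1 then -(if (⟨2, by omega⟩ : Fin (2*(h+1+1))) = j then 1 else 0)
    else if i.val = 2 then
      (if (⟨0, by omega⟩ : Fin (2*(h+1+1))) = j then 1 else 0)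
        + n * (if (⟨2, by omega⟩ : Fin (2*(h+1+1))) = j then 1 else 0)
    else if i.val = 3 then (if (⟨1, by omega⟩ : Fin (2*(h+1+1))) = j then 1 else 0)
    else (if i = j then 1 else 0)

lemma deltaTransition_mul_apply (h : ℕ) (n : ℤ)
    (M : Matrix (Fin (2*(h+1+1))) (Fin (2*(h+1+1))) ℤ) (i j : Fin (2*(h+1+1))) :
    (deltaTransition h n * M) i j =
      if i.val = 0 then -n * M ⟨1, by omega⟩ j + M ⟨3, by omega⟩ j
      else if i.val = 1 then -M ⟨2, by omega⟩ j
      else if i.val = 2 then M ⟨0, by omega⟩ j + n * M ⟨2, by omega⟩ j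
      else if i.val = 3 then M ⟨1, by omega⟩ j
      else M i j := by
  rw [Matrix.mul_apply]
  unfold deltaTransition
  simp only [Matrix.of_apply]
  split_ifs <;>
    simp [-Fin.mk_one, -Fin.zero_eta, -Fin.mk_zero, -Fin.mk_zero', -Fin.reduceFinMk, add_mul, Finset.sum_add_distrib]

lemma mul_deltaTransition_transpose_apply (h : ℕ) (n : ℤ)
    (M : Matrix (Fin (2*(h+1+1))) (Fin (2*(h+1+1))) ℤ) (i j : Fin (2*(h+1+1))) :
    (M * (deltaTransition h n)ᵀ) i j =
      if j.val = 0 then -n * M i ⟨1, by omega⟩ + M i ⟨3, by omega⟩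
      else if j.val = 1 then -M i ⟨2, by omega⟩
      else if j.val = 2 then M i ⟨0, by omega⟩ + n * M i ⟨2, by omega⟩
      else if j.val = 3 then M i ⟨1, by omega⟩
      else M i j := by
  have hT : M * (deltaTransition h n)ᵀ = (deltaTransition h n * Mᵀ)ᵀ := by
    rw [Matrix.transpose_mul, Matrix.transpose_transpose]
  rw [hT, Matrix.transpose_apply, deltaTransition_mul_apply]
  rfl

lemma fin_cases_four (h : ℕ) (i : Fin (2*(h+1+1))) :
    i = ⟨0, by omega⟩ ∨ i = ⟨1, by omega⟩ ∨ i = ⟨2, by omega⟩ ∨ i = ⟨3, by omega⟩ ∨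
      ∃ k, ∃ hk : k < 2*h, i = ⟨k+4, by omega⟩ := by
  obtain ⟨i, hi⟩ := i
  rcases i with _ | _ | _ | _ | k
  · simp
  · simp
  · simp
  · simp
  · exact Or.inr (Or.inr (Or.inr (Or.inr ⟨k, by omega, rfl⟩)))

lemma isSymplectic_deltaTransition (h : ℕ) (n : ℤ) : IsSymplectic (deltaTransition h n) := by
  unfold IsSymplectic
  ext i j
  rw [mul_deltaTransition_transpose_apply]
  simp only [deltaTransition_mul_apply]
  rcases fin_cases_four h i with rfl | rfl | rfl | rfl | ⟨k, hk, rfl⟩ <;>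
  rcases fin_cases_four h j with rfl | rfl | rfl | rfl | ⟨l, hl, rfl⟩ <;>
  simp [-Fin.mk_one, -Fin.zero_eta, -Fin.mk_zero, -Fin.mk_zero', -Fin.reduceFinMk, Jmat, Matrix.of_apply]

/-- integral version of Lemma `lemmadelta`, cf. Lemma `lemmastep`:
if `W = Δ_n V Δ_n` for integral Seifert matrices `V, W` with `n` a positive integer
dividing every entry of the second row of `V`, then some integral enlargements of `V`
and `W` are related by an integral symplectic congruence; in particular `V` and `W`
are integrally S-equivalent. -/
theorem delta_congruence_integral_enlargements {g : ℕ} (hg : 1 ≤ g)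
    (V W : Matrix (Fin (2*g)) (Fin (2*g)) ℤ)
    (hV : IsSeifert V) (hW : IsSeifert W)
    (n : ℕ) (hn : 0 < n)
    (hcong : W.map ((↑) : ℤ → ℚ) =
      Delta g (n : ℚ) * (V.map ((↑) : ℤ → ℚ)) * Delta g (n : ℚ))
    (hdiv : ∀ j, (n : ℤ) ∣ V ⟨1, by omega⟩ j) :
    (∃ (Vt Wt P : Matrix (Fin (2*(g+1))) (Fin (2*(g+1))) ℤ),
      IsEnlargement V Vt ∧ IsEnlargement W Wt ∧
      IsSymplectic P ∧ Wt = P * Vt * Pᵀ) ∧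
    IntSEquiv ⟨g, V⟩ ⟨g, W⟩ := by
  obtain ⟨h, rfl⟩ : ∃ h, g = h + 1 := ⟨g - 1, by omega⟩
  have hn0 : (n : ℚ) ≠ 0 := by positivity
  have entry (i j) : (W i j : ℚ) =
      (if i.val = 0 then (n : ℚ) else if i.val = 1 then (n : ℚ)⁻¹ else 1) * V i j *
      (if j.val = 0 then (n : ℚ) else if j.val = 1 then (n : ℚ)⁻¹ else 1) := by
    have := congrFun (congrFun hcong i) j
    simpa only [Delta, Matrix.mul_diagonal, Matrix.diagonal_mul, Matrix.map_apply] using this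
  have hVe (i j) : V i j - V j i = Jmat ℤ (h+1) i j := congrFun (congrFun hV i) j
  have hWe (i j) : W i j - W j i = Jmat ℤ (h+1) i j := congrFun (congrFun hW i) j
  choose ρ hρ using hdiv
  have W00 : W ⟨0, by omega⟩ ⟨0, by omega⟩ = n * V ⟨0, by omega⟩ ⟨0, by omega⟩ * n := by
    have := entry ⟨0, by omega⟩ ⟨0, by omega⟩
    simp only [if_true] at this
    exact_mod_cast this
  have W01 : W ⟨0, by omega⟩ ⟨1, by omega⟩ = V ⟨0, by omega⟩ ⟨1, by omega⟩ := by
    have := entry ⟨0, by omega⟩ ⟨1, by omega⟩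
    simp only [if_true, one_ne_zero, if_false] at this
    rw [mul_right_comm, mul_inv_cancel₀ hn0, one_mul] at this
    exact_mod_cast this
  have W10 : W ⟨1, by omega⟩ ⟨0, by omega⟩ = V ⟨1, by omega⟩ ⟨0, by omega⟩ := by
    have := entry ⟨1, by omega⟩ ⟨0, by omega⟩
    simp only [if_true, one_ne_zero, if_false] at this
    rw [mul_right_comm, inv_mul_cancel₀ hn0, one_mul] at this
    exact_mod_cast this
  have W11 : ρ ⟨1, by omega⟩ = n * W ⟨1, by omega⟩ ⟨1, by omega⟩ := by
    have := entry ⟨1, by omega⟩ ⟨1, by omega⟩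
    simp only [if_true, one_ne_zero, if_false, hρ] at this
    push_cast at this
    rw [inv_mul_cancel_left₀ hn0] at this
    have h2 : (ρ ⟨1, by omega⟩ : ℚ) = n * W ⟨1, by omega⟩ ⟨1, by omega⟩ := by
      rw [this]; field_simp
    exact_mod_cast h2
  have W0 (k : ℕ) (hk : k+2 < 2*(h+1)) : W ⟨0, by omega⟩ ⟨k+2, hk⟩ =
      n * V ⟨0, by omega⟩ ⟨k+2, hk⟩ := by
    have := entry ⟨0, by omega⟩ ⟨k+2, hk⟩
    simp [-Fin.mk_one, -Fin.zero_eta, -Fin.mk_zero, -Fin.mk_zero', -Fin.reduceFinMk] at this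
    exact_mod_cast this
  have W1 (k : ℕ) (hk : k+2 < 2*(h+1)) : W ⟨1, by omega⟩ ⟨k+2, hk⟩ = ρ ⟨k+2, hk⟩ := by
    have := entry ⟨1, by omega⟩ ⟨k+2, hk⟩
    simp only [hρ] at this
    simp [-Fin.mk_one, -Fin.zero_eta, -Fin.mk_zero, -Fin.mk_zero', -Fin.reduceFinMk, hn0] at this
    exact_mod_cast this
  have Wkl (k l : ℕ) (hk : k+2 < 2*(h+1)) (hl : l+2 < 2*(h+1)) : W ⟨k+2, hk⟩ ⟨l+2, hl⟩ =
      V ⟨k+2, hk⟩ ⟨l+2, hl⟩ := by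
    have := entry ⟨k+2, hk⟩ ⟨l+2, hl⟩
    simp [-Fin.mk_one, -Fin.zero_eta, -Fin.mk_zero, -Fin.mk_zero', -Fin.reduceFinMk] at this
    exact_mod_cast this
  have V01 : V ⟨0, by omega⟩ ⟨1, by omega⟩ = n * ρ ⟨0, by omega⟩ - 1 := by
    have := hVe ⟨0, by omega⟩ ⟨1, by omega⟩
    simp [-Fin.mk_one, -Fin.zero_eta, -Fin.mk_zero, -Fin.mk_zero', -Fin.reduceFinMk, Jmat, hρ] at this
    linarith
  have V0 (k : ℕ) (hk : k+2 < 2*(h+1)) : V ⟨k+2, hk⟩ ⟨0, by omega⟩ =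
      V ⟨0, by omega⟩ ⟨k+2, hk⟩ := by
    have := hVe ⟨k+2, hk⟩ ⟨0, by omega⟩
    simp [-Fin.mk_one, -Fin.zero_eta, -Fin.mk_zero, -Fin.mk_zero', -Fin.reduceFinMk, Jmat] at this
    linarith
  have V1 (k : ℕ) (hk : k+2 < 2*(h+1)) : V ⟨k+2, hk⟩ ⟨1, by omega⟩ = n * ρ ⟨k+2, hk⟩ := by
    have := hVe ⟨k+2, hk⟩ ⟨1, by omega⟩
    simp [-Fin.mk_one, -Fin.zero_eta, -Fin.mk_zero, -Fin.mk_zero', -Fin.reduceFinMk, Jmat, hρ] at this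
    linarith
  have W0' (k : ℕ) (hk : k+2 < 2*(h+1)) : W ⟨k+2, hk⟩ ⟨0, by omega⟩ =
      n * V ⟨0, by omega⟩ ⟨k+2, hk⟩ := by
    have := hWe ⟨k+2, hk⟩ ⟨0, by omega⟩
    simp [-Fin.mk_one, -Fin.zero_eta, -Fin.mk_zero, -Fin.mk_zero', -Fin.reduceFinMk, Jmat, W0 k hk] at this
    linarith
  have W1' (k : ℕ) (hk : k+2 < 2*(h+1)) : W ⟨k+2, hk⟩ ⟨1, by omega⟩ = ρ ⟨k+2, hk⟩ := by
    have := hWe ⟨k+2, hk⟩ ⟨1, by omega⟩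
    simp [-Fin.mk_one, -Fin.zero_eta, -Fin.mk_zero, -Fin.mk_zero', -Fin.reduceFinMk, Jmat, W1 k hk] at this
    linarith
  let x := W ⟨1, by omega⟩ ⟨1, by omega⟩
  let ρ' : Fin (2*(h+1)) → ℤ := fun j =>
    if j.val = 0 then -(n * V ⟨0, by omega⟩ ⟨0, by omega⟩)
    else if j.val = 1 then -ρ ⟨0, by omega⟩
    else -V ⟨0, by omega⟩ j
  have key : rowEnl W (V ⟨0, by omega⟩ ⟨0, by omega⟩) ρ' =
      deltaTransition h n * colEnl V x ρ * (deltaTransition h n)ᵀ := by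
    ext i j
    rw [mul_deltaTransition_transpose_apply]
    simp only [deltaTransition_mul_apply]
    rcases fin_cases_four h i with rfl | rfl | rfl | rfl | ⟨k, hk, rfl⟩ <;>
    rcases fin_cases_four h j with rfl | rfl | rfl | rfl | ⟨l, hl, rfl⟩ <;>
    simp [-Fin.mk_one, -Fin.zero_eta, -Fin.mk_zero, -Fin.mk_zero', -Fin.reduceFinMk,
      rowEnl, colEnl, ρ', x, V01, V0, V1, W00, W01, W10, W11,
      W0, W1, W0', W1', Wkl, hρ] <;> ring
  have hP := isSymplectic_deltaTransition h n
  refine ⟨⟨colEnl V x ρ, _, deltaTransition h n, ⟨x, ρ, Or.inr rfl⟩,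
    ⟨_, ρ', Or.inl rfl⟩, hP, key⟩, ?_⟩
  refine .trans _ _ _ (.rel _ _ (.col V x ρ))
    (.trans _ _ _ (.rel _ _ (.congr _ _ hP)) ?_)
  rw [← key]
  exact .symm _ _ (.rel _ _ (.row W _ ρ'))
end

section
/- Let V ∈ M_{2g}(ℚ) be an invertible Seifert matrix. Let R ⊆ (ℚ[t,t^{-1}])^{2g} be the ℚ[t,t^{-1}]-submodule generated by the columns of the matrix tV − Vᵗ. Then the ℚ-linear map φ : (ℚ[t,t^{-1}])^{2g} → ℚ^{2g} determined by φ(t^k X) = (Vᵗ V^{-1})^k X for all X ∈ ℚ^{2g} and k ∈ ℤ is surjective with kernel exactly R; consequently φ induces an isomorphism of ℚ[t,t^{-1}]-modules from (ℚ[t,t^{-1}])^{2g}/R to ℚ^{2g} equipped with the ℚ[t,t^{-1}]-module structure in which t acts by the invertible matrix Vᵗ V^{-1}. -/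
open Matrix

open LaurentPolynomial

/-- The matrix `tV - Vᵀ` over the Laurent polynomial ring. -/
noncomputable def seifPres {g : ℕ} (V : Matrix (Fin (2*g)) (Fin (2*g)) ℚ) :
    Matrix (Fin (2*g)) (Fin (2*g)) (LaurentPolynomial ℚ) :=
  Matrix.of fun i j => T 1 * C (V i j) - C (V j i)

/-- The `ℚ[t,t⁻¹]`-submodule of `(ℚ[t,t⁻¹])^{2g}` generated by the columns of `tV - Vᵀ`. -/
noncomputable def seifCols {g : ℕ} (V : Matrix (Fin (2*g)) (Fin (2*g)) ℚ) :
    Submodule (LaurentPolynomial ℚ) (Fin (2*g) → LaurentPolynomial ℚ) :=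
  Submodule.span _ {c | ∃ j, c = fun i => seifPres V i j}

namespace LaurentPolynomial

variable {K n : Type*} [CommRing K]

/-- Constant vectors inside the free module over the Laurent polynomials. -/
noncomputable def constVec : (n → K) →+ (n → K[T;T⁻¹]) where
  toFun X i := C (X i)
  map_zero' := by ext1; simp
  map_add' X Y := by ext1; simp

@[simp]
theorem constVec_apply (X : n → K) (i : n) : constVec X i = C (X i) := rfl

theorem constVec_smul (a : K) (X : n → K) :
    constVec (a • X) = (C a : K[T;T⁻¹]) • constVec X := by
  ext1; simp

variable [Fintype n] [DecidableEq n]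

/-- Evaluation of Laurent polynomials at an invertible matrix. -/
noncomputable def matrixEval (u : (Matrix n n K)ˣ) : K[T;T⁻¹] →ₐ[K] Matrix n n K :=
  AddMonoidAlgebra.lift K (Matrix n n K) ℤ ((Units.coeHom _).comp (zpowersHom _ u))

theorem matrixEval_T (u : (Matrix n n K)ˣ) (k : ℤ) :
    matrixEval u (T k) = ((u ^ k : (Matrix n n K)ˣ) : Matrix n n K) := by
  rw [matrixEval, T, AddMonoidAlgebra.lift_single, one_smul]
  rfl

theorem matrixEval_C (u : (Matrix n n K)ˣ) (a : K) :
    matrixEval u (C a) = algebraMap K _ a :=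
  (matrixEval u).commutes a

theorem matrixEval_C_mulVec (u : (Matrix n n K)ˣ) (a : K) (X : n → K) :
    matrixEval u (C a) *ᵥ X = a • X := by
  rw [matrixEval_C, Algebra.algebraMap_eq_smul_one, smul_mulVec, one_mulVec]

/-- The `K`-linear map sending `t ^ k X` to `u ^ k X`. -/
noncomputable def vecEval (u : (Matrix n n K)ˣ) : (n → K[T;T⁻¹]) →ₗ[K] (n → K) where
  toFun v := ∑ i, matrixEval u (v i) *ᵥ Pi.single i 1
  map_add' v w := by simp only [Pi.add_apply, map_add, add_mulVec, Finset.sum_add_distrib]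
  map_smul' a v := by
    simp only [Pi.smul_apply, map_smul, smul_mulVec, Finset.smul_sum, RingHom.id_apply]

theorem vecEval_apply (u : (Matrix n n K)ˣ) (v : n → K[T;T⁻¹]) :
    vecEval u v = ∑ i, matrixEval u (v i) *ᵥ Pi.single i 1 := rfl

theorem vecEval_smul (u : (Matrix n n K)ˣ) (p : K[T;T⁻¹]) (v : n → K[T;T⁻¹]) :
    vecEval u (p • v) = matrixEval u p *ᵥ vecEval u v := by
  simp only [vecEval_apply, Pi.smul_apply, smul_eq_mul, map_mul, mulVec_sum, mulVec_mulVec]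

theorem vecEval_constVec (u : (Matrix n n K)ˣ) (X : n → K) : vecEval u (constVec X) = X := by
  simp only [vecEval_apply, constVec_apply, matrixEval_C_mulVec]
  exact (pi_eq_sum_univ' X).symm

theorem smul_constVec_sub_mem (u : (Matrix n n K)ˣ) {N : Submodule K[T;T⁻¹] (n → K[T;T⁻¹])}
    (hN : ∀ X : n → K, (T 1 : K[T;T⁻¹]) • constVec X - constVec (u.1 *ᵥ X) ∈ N)
    (p : K[T;T⁻¹]) (X : n → K) :
    p • constVec X - constVec (matrixEval u p *ᵥ X) ∈ N := by
  induction p using LaurentPolynomial.induction_on generalizing X with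
  | h_C a => simp [matrixEval_C_mulVec, constVec_smul]
  | h_add hp hq =>
    rw [map_add, add_mulVec, map_add, add_smul, add_sub_add_comm]
    exact N.add_mem (hp X) (hq X)
  | h_C_mul_T k a h =>
    have h₁ := N.add_mem (N.smul_mem (C a * T k) (hN X)) (h (u.1 *ᵥ X))
    convert h₁ using 1
    rw [T_add, ← mul_assoc, map_mul _ _ (T 1), matrixEval_T u 1, zpow_one, ← mulVec_mulVec,
      smul_sub, mul_smul _ (T 1)]
    abel
  | h_C_mul_T_Z k a h =>
    have h₁ := N.sub_mem (h (u⁻¹.1 *ᵥ X)) (N.smul_mem (C a * T (-k - 1)) (hN (u⁻¹.1 *ᵥ X)))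
    convert h₁ using 1
    have hT : (C a * T (-k) : K[T;T⁻¹]) = C a * T (-k - 1) * T 1 := by
      rw [mul_assoc, ← T_add, sub_add_cancel]
    have hX : u.1 *ᵥ u⁻¹.1 *ᵥ X = X := by rw [mulVec_mulVec, Units.mul_inv, one_mulVec]
    have hev : matrixEval u (C a * T (-k - 1)) *ᵥ X =
        matrixEval u (C a * T (-k)) *ᵥ u⁻¹.1 *ᵥ X := by
      rw [hT, map_mul _ _ (T 1), matrixEval_T u 1, zpow_one, ← mulVec_mulVec, hX]
    rw [hX, hev, smul_sub, smul_smul, ← hT]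
    abel

theorem sub_constVec_vecEval_mem (u : (Matrix n n K)ˣ)
    {N : Submodule K[T;T⁻¹] (n → K[T;T⁻¹])}
    (hN : ∀ X : n → K, (T 1 : K[T;T⁻¹]) • constVec X - constVec (u.1 *ᵥ X) ∈ N)
    (v : n → K[T;T⁻¹]) : v - constVec (vecEval u v) ∈ N := by
  have hv : v = ∑ i, v i • constVec (Pi.single i (1 : K)) := by
    ext1 j
    simp [Finset.sum_apply, Pi.single_apply, apply_ite]
  rw [vecEval_apply, map_sum]
  nth_rewrite 1 [hv]
  rw [← Finset.sum_sub_distrib]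
  exact N.sum_mem fun i _ => smul_constVec_sub_mem u hN _ _

end LaurentPolynomial

theorem seifPres_col_eq {g : ℕ} (V : Matrix (Fin (2*g)) (Fin (2*g)) ℚ) (j : Fin (2*g)) :
    (fun i => seifPres V i j) = (T 1 : LaurentPolynomial ℚ) • constVec (V.col j) -
      constVec (Vᵀ.col j) := by
  ext1 i
  simp [seifPres]

theorem seifPres_mulVec_mem_seifCols {g : ℕ} (V : Matrix (Fin (2*g)) (Fin (2*g)) ℚ)
    (Y : Fin (2*g) → ℚ) :
    (T 1 : LaurentPolynomial ℚ) • constVec (V *ᵥ Y) - constVec (Vᵀ *ᵥ Y) ∈ seifCols V := by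
  have h : (T 1 : LaurentPolynomial ℚ) • constVec (V *ᵥ Y) - constVec (Vᵀ *ᵥ Y) =
      ∑ j, (C (Y j) : LaurentPolynomial ℚ) • fun i => seifPres V i j := by
    ext1 i
    simp only [Pi.sub_apply, Pi.smul_apply, smul_eq_mul, constVec_apply, mulVec, dotProduct,
      map_sum, map_mul, Finset.mul_sum, Finset.sum_apply, seifPres, of_apply, transpose_apply,
      ← Finset.sum_sub_distrib]
    exact Finset.sum_congr rfl fun j _ => by ring
  rw [h]
  exact Submodule.sum_mem _ fun j _ =>
    Submodule.smul_mem _ _ (Submodule.subset_span ⟨j, rfl⟩)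

/-- Lemma `lemmaQbase`: for an invertible Seifert matrix `V`, the
`ℚ`-linear map `φ` with `φ(t^k X) = (VᵀV⁻¹)^k X` is surjective with kernel the column
span of `tV - Vᵀ`, and induces an isomorphism from the presented Alexander module to
`ℚ^{2g}` with `t` acting by `VᵀV⁻¹`. -/
theorem alexander_module_basis {g : ℕ}
    (V : Matrix (Fin (2*g)) (Fin (2*g)) ℚ) (hV : IsSeifert V) (hVinv : IsUnit V.det) :
    ∃ φ : (Fin (2*g) → LaurentPolynomial ℚ) →ₗ[ℚ] (Fin (2*g) → ℚ),
      (∀ (k : ℤ) (X : Fin (2*g) → ℚ),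
        φ (fun i => T k * C (X i)) = ((Vᵀ * V⁻¹) ^ k) *ᵥ X) ∧
      Function.Surjective φ ∧
      (∀ v, φ v = 0 ↔ v ∈ seifCols V) ∧
      ∃ e : ((Fin (2*g) → LaurentPolynomial ℚ) ⧸ seifCols V) ≃ₗ[ℚ] (Fin (2*g) → ℚ),
        (∀ v, e (Submodule.Quotient.mk v) = φ v) ∧
        (∀ v : Fin (2*g) → LaurentPolynomial ℚ,
          e (Submodule.Quotient.mk ((T 1 : LaurentPolynomial ℚ) • v)) =
            (Vᵀ * V⁻¹) *ᵥ e (Submodule.Quotient.mk v)) := by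
  have hA : IsUnit (Vᵀ * V⁻¹) := by
    rw [isUnit_iff_isUnit_det, det_mul, det_transpose]
    exact hVinv.mul (isUnit_nonsing_inv_det V hVinv)
  obtain ⟨u, hu⟩ := hA
  have hAV : (Vᵀ * V⁻¹) * V = Vᵀ := nonsing_inv_mul_cancel_right V Vᵀ hVinv
  have hN (X : Fin (2*g) → ℚ) :
      (T 1 : LaurentPolynomial ℚ) • constVec X - constVec (u.1 *ᵥ X) ∈ seifCols V := by
    have h := seifPres_mulVec_mem_seifCols V (V⁻¹ *ᵥ X)
    rwa [mulVec_mulVec, mulVec_mulVec, mul_nonsing_inv V hVinv, one_mulVec, ← hu] at h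
  have hT (v : Fin (2*g) → LaurentPolynomial ℚ) :
      vecEval u ((T 1 : LaurentPolynomial ℚ) • v) = (Vᵀ * V⁻¹) *ᵥ vecEval u v := by
    rw [vecEval_smul, matrixEval_T, zpow_one, hu]
  have hsurj : Function.Surjective (vecEval u) := fun X => ⟨_, vecEval_constVec u X⟩
  have hker (v : Fin (2*g) → LaurentPolynomial ℚ) : vecEval u v = 0 ↔ v ∈ seifCols V := by
    refine ⟨fun hv => ?_, fun hv => ?_⟩
    · simpa [hv] using sub_constVec_vecEval_mem u hN v
    · induction hv using Submodule.span_induction with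
      | mem x hx =>
        obtain ⟨j, rfl⟩ := hx
        rw [seifPres_col_eq, map_sub, hT, vecEval_constVec, vecEval_constVec,
          ← mulVec_single_one, mulVec_mulVec, hAV, mulVec_single_one, sub_self]
      | zero => exact map_zero _
      | add x y _ _ hx hy => rw [map_add, hx, hy, add_zero]
      | smul p x _ hx => rw [vecEval_smul, hx, mulVec_zero]
  have hker' : (seifCols V).restrictScalars ℚ = LinearMap.ker (vecEval u) := by
    ext v
    exact (hker v).symm
  let e : ((Fin (2*g) → LaurentPolynomial ℚ) ⧸ seifCols V) ≃ₗ[ℚ] (Fin (2*g) → ℚ) :=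
    (Submodule.Quotient.restrictScalarsEquiv ℚ (seifCols V)).symm ≪≫ₗ
      Submodule.quotEquivOfEq _ _ hker' ≪≫ₗ (vecEval u).quotKerEquivOfSurjective hsurj
  have he (v : Fin (2*g) → LaurentPolynomial ℚ) : e (Submodule.Quotient.mk v) = vecEval u v := rfl
  refine ⟨vecEval u, fun k X => ?_, hsurj, hker, e, he, fun v => ?_⟩
  · have h : (fun i => T k * C (X i)) = (T k : LaurentPolynomial ℚ) • constVec X := rfl
    rw [h, vecEval_smul, vecEval_constVec, matrixEval_T, coe_units_zpow, hu]
  · rw [he, he, hT]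
end

section
/- Let V ∈ M_{2g}(ℤ) be an integral Seifert matrix. Then the quotient of the free ℤ[t,t^{-1}]-module (ℤ[t,t^{-1}])^{2g} by the submodule generated by the columns of the matrix tV − Vᵗ is torsion-free as an abelian group; that is, if k is a nonzero integer and a is an element of the quotient with k·a = 0, then a = 0. -/
open Matrix

open LaurentPolynomial

/-- The matrix `tV - Vᵀ` over `ℤ[t,t⁻¹]`. -/
noncomputable def seifPresZ {g : ℕ} (V : Matrix (Fin (2*g)) (Fin (2*g)) ℤ) :
    Matrix (Fin (2*g)) (Fin (2*g)) (LaurentPolynomial ℤ) :=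
  Matrix.of fun i j => T 1 * C (V i j) - C (V j i)

/-- The `ℤ[t,t⁻¹]`-submodule of `(ℤ[t,t⁻¹])^{2g}` generated by the columns of `tV - Vᵀ`. -/
noncomputable def seifColsZ {g : ℕ} (V : Matrix (Fin (2*g)) (Fin (2*g)) ℤ) :
    Submodule (LaurentPolynomial ℤ) (Fin (2*g) → LaurentPolynomial ℤ) :=
  Submodule.span _ {c | ∃ j, c = fun i => seifPresZ V i j}

/-- A Laurent polynomial whose coefficients all vanish modulo `q` is a multiple of `q`. -/
theorem LaurentPolynomial.exists_eq_smul_of_map_mk_eq_zero {R : Type*} [CommRing R] {q : R}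
    {f : R[T;T⁻¹]}
    (hf : AddMonoidAlgebra.mapRingHom ℤ (Ideal.Quotient.mk (Ideal.span {q})) f = 0) :
    ∃ h : R[T;T⁻¹], f = q • h := by
  have hdvd : ∀ n, q ∣ f.coeff n := fun n => by
    have hn := congrArg (fun x => x.coeff n) hf
    simpa [Ideal.Quotient.eq_zero_iff_mem, Ideal.mem_span_singleton] using hn
  choose c hc using hdvd
  refine ⟨∑ n ∈ f.coeff.support, .single n (c n), ?_⟩
  ext n
  by_cases hn : f.coeff n = 0
  · simp [Finsupp.single_apply, hn, -single_eq_C_mul_T]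
  · simp [Finsupp.single_apply, hn, -single_eq_C_mul_T, ← hc]

/-- If the determinant of a square matrix over `R[T;T⁻¹]` is nonzero modulo the prime `q`, then
the cokernel of the matrix has no `q`-torsion. -/
theorem Matrix.exists_mulVec_eq_of_smul_eq_mulVec {R n : Type*} [CommRing R] [IsDomain R]
    [Fintype n] [DecidableEq n] {q : R} (hq : Prime q) {M : Matrix n n R[T;T⁻¹]}
    (hM : AddMonoidAlgebra.mapRingHom ℤ (Ideal.Quotient.mk (Ideal.span {q})) M.det ≠ 0)
    {x y : n → R[T;T⁻¹]} (hxy : q • x = M *ᵥ y) : ∃ z, x = M *ᵥ z := by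
  set φ := AddMonoidAlgebra.mapRingHom ℤ (Ideal.Quotient.mk (Ideal.span {q})) with hφ
  have : (Ideal.span {q}).IsPrime := (Ideal.span_singleton_prime hq.ne_zero).2 hq
  have hφq : ∀ f : R[T;T⁻¹], φ (q • f) = 0 := fun f => by
    have hq0 : Ideal.Quotient.mk (Ideal.span {q}) q = 0 :=
      Ideal.Quotient.eq_zero_iff_mem.2 (Ideal.mem_span_singleton_self q)
    ext m
    simp [hφ, hq0]
  have hy : φ ∘ y = 0 := by
    refine Matrix.eq_zero_of_mulVec_eq_zero (M := φ.mapMatrix M) ?_ ?_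
    · rwa [← RingHom.map_det]
    · ext1 i
      rw [RingHom.mapMatrix_apply, ← RingHom.map_mulVec, ← hxy]
      exact hφq (x i)
  choose z hz using fun i =>
    LaurentPolynomial.exists_eq_smul_of_map_mk_eq_zero (f := y i) (congrFun hy i)
  refine ⟨z, ?_⟩
  have hyz : y = q • z := funext hz
  rw [hyz, Matrix.mulVec_smul] at hxy
  ext i m
  have := congrArg (fun f => f.coeff m) (congrFun hxy i)
  simpa [hq.ne_zero] using this

theorem Jmat_mul_transpose (R : Type*) [CommRing R] (g : ℕ) : Jmat R g * (Jmat R g)ᵀ = 1 := by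
  let σ : Fin (2 * g) → Fin (2 * g) := fun i =>
    if h : i.val % 2 = 0 then ⟨i + 1, by omega⟩ else ⟨i - 1, by omega⟩
  let s : Fin (2 * g) → R := fun i => if i.val % 2 = 0 then -1 else 1
  have hσ : Function.Injective σ := fun i j hij => by
    simp only [σ] at hij
    split_ifs at hij <;> simp only [Fin.mk.injEq] at hij <;> ext <;> omega
  have hJ : ∀ i j, Jmat R g i j = if j = σ i then s i else 0 := fun i j => by
    simp only [Jmat, Matrix.of_apply, σ, s, Fin.ext_iff]
    split_ifs <;> first | rfl | (exfalso; simp only at *; omega)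
  have hs : ∀ i, s i * s i = 1 := fun i => by
    simp only [s]
    split_ifs <;> simp
  ext i j
  by_cases hij : i = j
  · subst hij
    simp [Matrix.mul_apply, hJ, hs]
  · simp [Matrix.mul_apply, hJ, hij, Ne.symm hij, hσ.eq_iff]

theorem isUnit_det_Jmat (R : Type*) [CommRing R] (g : ℕ) : IsUnit (Jmat R g).det :=
  Matrix.isUnit_det_of_right_inverse (Jmat_mul_transpose R g)

theorem map_det_seifPresZ_ne_zero {g : ℕ} {V : Matrix (Fin (2*g)) (Fin (2*g)) ℤ}
    (hV : IsSeifert V) {S : Type*} [CommRing S] [Nontrivial S] (f : ℤ →+* S) :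
    AddMonoidAlgebra.mapRingHom ℤ f (seifPresZ V).det ≠ 0 := by
  intro h
  have hM : (LaurentPolynomial.eval₂ (RingHom.id S) 1).mapMatrix
      ((AddMonoidAlgebra.mapRingHom ℤ f).mapMatrix (seifPresZ V)) = f.mapMatrix (Jmat ℤ g) := by
    have hT : AddMonoidAlgebra.mapRingHom ℤ f (T 1) = (T 1 : S[T;T⁻¹]) := by
      simp [T, -single_eq_C_mul_T]
    have hC : ∀ a, AddMonoidAlgebra.mapRingHom ℤ f (C a) = (C (f a) : S[T;T⁻¹]) := fun a => by
      simp
    rw [← hV]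
    ext i j
    simp only [RingHom.mapMatrix_apply, Matrix.map_apply, seifPresZ, Matrix.of_apply, map_sub,
      map_mul, hT, hC, Matrix.sub_apply, Matrix.transpose_apply]
    simp
  apply ((isUnit_det_Jmat ℤ g).map f).ne_zero
  rw [RingHom.map_det, ← hM, ← RingHom.map_det, ← RingHom.map_det, h, map_zero]

theorem mem_seifColsZ_iff {g : ℕ} (V : Matrix (Fin (2*g)) (Fin (2*g)) ℤ)
    (x : Fin (2*g) → ℤ[T;T⁻¹]) : x ∈ seifColsZ V ↔ ∃ y, x = seifPresZ V *ᵥ y := by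
  have hspan : seifColsZ V = LinearMap.range (seifPresZ V).mulVecLin := by
    rw [Matrix.range_mulVecLin, seifColsZ]
    congr 1
    ext c
    exact exists_congr fun j => eq_comm
  simp [hspan, eq_comm]

/-- the integral Alexander module presented by `tV - Vᵀ`, for an
integral Seifert matrix `V`, has no `ℤ`-torsion. -/
theorem integral_alexander_module_torsionFree {g : ℕ}
    (V : Matrix (Fin (2*g)) (Fin (2*g)) ℤ) (hV : IsSeifert V) :
    ∀ k : ℤ, k ≠ 0 →
      ∀ a : (Fin (2*g) → LaurentPolynomial ℤ) ⧸ seifColsZ V, k • a = 0 → a = 0 := by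
  suffices key : ∀ k : ℤ, k ≠ 0 → ∀ x, k • x ∈ seifColsZ V → x ∈ seifColsZ V by
    intro k hk a
    induction a using Submodule.Quotient.induction_on with
    | _ x =>
      intro h
      rw [← Submodule.Quotient.mk_smul, Submodule.Quotient.mk_eq_zero] at h
      exact (Submodule.Quotient.mk_eq_zero _).2 (key k hk x h)
  intro k
  induction k using UniqueFactorizationMonoid.induction_on_prime with
  | h₁ => exact fun h => absurd rfl h
  | h₂ u hu =>
    intro _ x hx
    obtain ⟨v, rfl⟩ := hu
    have := Submodule.smul_of_tower_mem (seifColsZ V) (↑v⁻¹ : ℤ) hx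
    rwa [smul_smul, Units.inv_mul, one_smul] at this
  | h₃ k q hk hq ih =>
    intro _ x hx
    refine ih hk x ?_
    rw [mul_smul, mem_seifColsZ_iff] at hx
    obtain ⟨y, hy⟩ := hx
    have : (Ideal.span {q}).IsPrime := (Ideal.span_singleton_prime hq.ne_zero).2 hq
    exact (mem_seifColsZ_iff V _).2 (Matrix.exists_mulVec_eq_of_smul_eq_mulVec hq
      (map_det_seifPresZ_ne_zero hV _) hy)
end

section
/- Let W = [[1−t, −1],[t, 2t−2]] and W' = [[3t−3, t−2],[2t−1, 0]], viewed as 2×2 matrices over ℤ[t,t^{-1}]. Then det W = (2t−1)(2−t) = det W', but the ℤ[t,t^{-1}]-modules (ℤ[t,t^{-1}])²/⟨columns of W⟩ and (ℤ[t,t^{-1}])²/⟨columns of W'⟩ are not isomorphic. -/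
open Matrix LaurentPolynomial

/-- The `ℤ[t,t⁻¹]`-submodule of `(ℤ[t,t⁻¹])²` generated by the columns of a `2×2`
matrix over `ℤ[t,t⁻¹]`. -/
noncomputable def colSpan2 (M : Matrix (Fin 2) (Fin 2) (LaurentPolynomial ℤ)) :
    Submodule (LaurentPolynomial ℤ) (Fin 2 → LaurentPolynomial ℤ) :=
  Submodule.span _ {c | ∃ j, c = fun i => M i j}

/-- The ring homomorphism `ℤ[t,t⁻¹] → 𝔽₃` sending `t` to `-1`. -/
noncomputable def evalNegOneModThree : LaurentPolynomial ℤ →+* ZMod 3 :=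
  eval₂ (Int.castRingHom (ZMod 3)) (-1)

lemma evalNegOneModThree_T_one : evalNegOneModThree (T 1) = -1 := by
  simp [evalNegOneModThree]

/-- If the top right entry of `M` is `-1`, the cokernel of `M` is generated by the class of the
second basis vector. -/
lemma exists_smul_mkQ_single_one_of_entry_eq_neg_one
    {M : Matrix (Fin 2) (Fin 2) (LaurentPolynomial ℤ)} (hM : M 0 1 = -1)
    (x : (Fin 2 → LaurentPolynomial ℤ) ⧸ colSpan2 M) :
    ∃ r : LaurentPolynomial ℤ, x = r • (colSpan2 M).mkQ (Pi.single 1 1) := by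
  obtain ⟨u, rfl⟩ := (colSpan2 M).mkQ_surjective x
  refine ⟨u 1 + u 0 * M 1 1, ?_⟩
  rw [← map_smul, ← sub_eq_zero, ← map_sub, Submodule.mkQ_apply, Submodule.Quotient.mk_eq_zero]
  have hcol : (fun i => M i 1) ∈ colSpan2 M := Submodule.subset_span ⟨1, rfl⟩
  convert (colSpan2 M).smul_mem (-u 0) hcol using 1
  ext1 i
  fin_cases i
  · simp [hM]
  · simp

/-- If all entries of `M` vanish under a ring homomorphism to a nontrivial commutative ring, then
the cokernel of `M` is not cyclic. -/
lemma not_exists_generator_of_map_entries_eq_zero {k : Type*} [CommRing k] [Nontrivial k]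
    (f : LaurentPolynomial ℤ →+* k) {M : Matrix (Fin 2) (Fin 2) (LaurentPolynomial ℤ)}
    (hM : ∀ i j, f (M i j) = 0) :
    ¬ ∃ g : (Fin 2 → LaurentPolynomial ℤ) ⧸ colSpan2 M,
      ∀ x, ∃ r : LaurentPolynomial ℤ, x = r • g := by
  rintro ⟨g, hg⟩
  obtain ⟨v, rfl⟩ := (colSpan2 M).mkQ_surjective g
  have hspan : ∀ w ∈ colSpan2 M, ∀ i, f (w i) = 0 := by
    intro w hw
    induction hw using Submodule.span_induction with
    | mem w h => obtain ⟨j, rfl⟩ := h; exact fun i => hM i j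
    | zero => simp
    | add a b _ _ ha hb => intro i; simp [ha i, hb i]
    | smul r a _ ha => intro i; simp [ha i]
  have hmul (u : Fin 2 → LaurentPolynomial ℤ) : ∃ a : k, ∀ i, f (u i) = a * f (v i) := by
    obtain ⟨r, hr⟩ := hg ((colSpan2 M).mkQ u)
    rw [← map_smul, ← sub_eq_zero, ← map_sub, Submodule.mkQ_apply,
      Submodule.Quotient.mk_eq_zero] at hr
    exact ⟨f r, fun i => sub_eq_zero.mp (by simpa using hspan _ hr i)⟩
  obtain ⟨a, ha⟩ := hmul (Pi.single 0 1)
  obtain ⟨b, hb⟩ := hmul (Pi.single 1 1)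
  have ha0 : 1 = a * f (v 0) := by simpa using ha 0
  have ha1 : 0 = a * f (v 1) := by simpa using ha 1
  have hb1 : 1 = b * f (v 1) := by simpa using hb 1
  exact one_ne_zero (α := k) (by linear_combination ha0 + a * f (v 0) * hb1 - b * f (v 0) * ha1)

/-- Lemma `lemmaex`: the matrices `W = [[1-t,-1],[t,2t-2]]` and
`W' = [[3t-3,t-2],[2t-1,0]]` have the same determinant `(2t-1)(2-t)`, but present
non-isomorphic `ℤ[t,t⁻¹]`-modules. -/
theorem same_det_not_isomorphic_presentations :
    let t : LaurentPolynomial ℤ := T 1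
    let W : Matrix (Fin 2) (Fin 2) (LaurentPolynomial ℤ) := !![1 - t, -1; t, 2*t - 2]
    let W' : Matrix (Fin 2) (Fin 2) (LaurentPolynomial ℤ) := !![3*t - 3, t - 2; 2*t - 1, 0]
    W.det = (2*t - 1) * (2 - t) ∧ W'.det = (2*t - 1) * (2 - t) ∧
    ¬ Nonempty (((Fin 2 → LaurentPolynomial ℤ) ⧸ colSpan2 W) ≃ₗ[LaurentPolynomial ℤ]
        ((Fin 2 → LaurentPolynomial ℤ) ⧸ colSpan2 W')) := by
  intro t W W'
  refine ⟨by simp only [W, det_fin_two_of]; ring, by simp only [W', det_fin_two_of]; ring, ?_⟩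
  rintro ⟨e⟩
  have ht : evalNegOneModThree t = -1 := evalNegOneModThree_T_one
  have htwo : evalNegOneModThree 2 = 2 := map_ofNat _ 2
  have hthree : evalNegOneModThree 3 = 3 := map_ofNat _ 3
  have hW' : ∀ i j, evalNegOneModThree (W' i j) = 0 := by
    intro i j
    fin_cases i <;> fin_cases j <;> simp [W', ht, htwo, hthree] <;> decide
  refine not_exists_generator_of_map_entries_eq_zero evalNegOneModThree hW'
    ⟨e ((colSpan2 W).mkQ (Pi.single 1 1)), fun x => ?_⟩
  obtain ⟨r, hr⟩ := exists_smul_mkQ_single_one_of_entry_eq_neg_one (M := W) rfl (e.symm x)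
  exact ⟨r, by rw [← map_smul, ← hr, e.apply_symm_apply]⟩
end
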